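/- arXiv:math/0110048 — 2 statements merged into one kernel-verified Lean document; each statement's English description precedes it below -/
import Mathlib

section
/- Let δ be a nonzero integer with d = v_p(δ) (the p-adic valuation of δ) satisfying 0 ≤ d ≤ n−1. Then the conductor of F((ζ_{p^n}^δ)^{1/p^n})/F is f_n(ζ_{p^n}^δ) = p^{n−1}·((n−d)(p−1) + 1). -/
/-- Membership in the group `F^r`: `x ∈ F^×` such that for every `σ ∈ Gal(F/E)`,
`σ(x)·x^{-c_σ^r} ∈ F^{×p^n}`, where `c_σ` is the cyclotomic character value of `σ`
(encoded as a unit of `ZMod (p^n)`). -/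
def memFr (p n : ℕ) (E : Type) {F : Type} [Field E] [Field F] [Algebra E F]
    (ζ : F) (r : ℤ) (x : F) : Prop :=
  x ≠ 0 ∧ ∀ (σ : F ≃ₐ[E] F) (u : (ZMod (p ^ n))ˣ),
    σ ζ = ζ ^ ((u : ZMod (p ^ n)).val) →
      ∃ w : F, σ x * (x ^ (((u ^ r : (ZMod (p ^ n))ˣ) : ZMod (p ^ n)).val))⁻¹ = w ^ (p ^ n)

/-- `b` is a norm from `F(y)` down to `F`. -/
def isNormFrom {F : Type} [Field F] (y : AlgebraicClosure F) (b : F) : Prop :=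
  ∃ z : IntermediateField.adjoin F {y}, Algebra.norm F z = b

/-- The set of integers `f ≥ 0` such that every unit `u` of `F` with `v(u-1) ≥ f`
is a norm from `F(y)`; its least element is the conductor of `F(y)/F`. -/
def condSet {F : Type} [Field F] (v : AddValuation F (WithTop ℤ))
    (y : AlgebraicClosure F) : Set ℕ :=
  {f : ℕ | ∀ u : F, v u = 0 → ((f : ℤ) : WithTop ℤ) ≤ v (u - 1) → isNormFrom y u}

section Conductor

open Polynomial

/-- The norm of `g(X)` from `R[X]` down to `R[X ^ p]`, read as a polynomial in `X ^ p`. -/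
noncomputable def colemanNorm {R : Type*} [CommRing R] (p : ℕ) (g : R[X]) : R[X] :=
  resultant (X ^ p - C X : R[X][X]) (g.map C) p g.natDegree

section ColemanNorm

variable {R S : Type*} [CommRing R] [CommRing S] {p : ℕ}

lemma colemanNorm_eq_of_natDegree_le (hp : p ≠ 0) {g : R[X]} {n : ℕ} (hn : g.natDegree ≤ n) :
    colemanNorm p g = resultant (X ^ p - C X : R[X][X]) (g.map C) p n := by
  obtain ⟨k, rfl⟩ := Nat.exists_eq_add_of_le hn
  rw [resultant_add_right_deg _ _ _ _ _ natDegree_map_le]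
  simp [colemanNorm, coeff_X_pow, coeff_C, hp]

lemma colemanNorm_map (hp : p ≠ 0) (φ : R →+* S) (g : R[X]) :
    colemanNorm p (g.map φ) = (colemanNorm p g).map φ := by
  rw [colemanNorm_eq_of_natDegree_le hp (natDegree_map_le (f := φ)), colemanNorm,
    ← coe_mapRingHom φ, ← resultant_map_map]
  congr 1
  · simp
  · simp only [Polynomial.map_map]
    ext
    simp

lemma eval_colemanNorm (g : R[X]) (x : R) :
    (colemanNorm p g).eval x = resultant (X ^ p - C x) g p g.natDegree := by
  rw [← coe_evalRingHom, colemanNorm, ← resultant_map_map]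
  congr 1
  · simp
  · rw [Polynomial.map_map]
    convert Polynomial.map_id
    ext
    simp

lemma eval_colemanNorm_eq_prod_nthRoots [IsDomain R] (hp : p ≠ 0) (g : R[X]) (x : R)
    (hs : (X ^ p - C x).Splits) :
    (colemanNorm p g).eval x = ((nthRoots p x).map g.eval).prod := by
  have h := resultant_eq_prod_eval (X ^ p - C x) g g.natDegree le_rfl hs
  rw [natDegree_X_pow_sub_C] at h
  rw [eval_colemanNorm, h, nthRoots, leadingCoeff_X_pow_sub_C (Nat.pos_of_ne_zero hp),
    one_pow, one_mul]

lemma expand_colemanNorm [Fact p.Prime] [CharP R p] (g : R[X]) :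
    expand R p (colemanNorm p g) = g ^ p := by
  have hp : p ≠ 0 := (Fact.out : p.Prime).ne_zero
  change (expand R p : R[X] →+* R[X]) _ = _
  rw [colemanNorm, ← resultant_map_map]
  have h1 : (X ^ p - C X : R[X][X]).map (expand R p : R[X] →+* R[X]) = (X - C X) ^ p := by
    rw [sub_pow_char]
    simp
  have h2 : (g.map C).map (expand R p : R[X] →+* R[X]) = g.map C := by
    rw [Polynomial.map_map]
    congr 1
    ext
    simp
  rw [h1, h2, resultant_X_sub_C_pow_left _ _ _ _ natDegree_map_le, ← Polynomial.eval₂_eq_eval_map]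
  simp [eval₂_C_X]

lemma dvd_coeff_colemanNorm_sub [Fact p.Prime] (g : ℤ_[p][X]) (j : ℕ) :
    (p : ℤ_[p]) ∣ (colemanNorm p g).coeff j - g.coeff j := by
  have hp : p ≠ 0 := (Fact.out : p.Prime).ne_zero
  let φ : ℤ_[p] →+* ZMod p := PadicInt.toZMod
  have h : (colemanNorm p g).map φ = g.map φ := by
    apply expand_injective (Nat.pos_of_ne_zero hp)
    rw [← colemanNorm_map hp, expand_colemanNorm, ZMod.expand_card]
  have h2 := congrArg (fun f => f.coeff j) h
  simp only [coeff_map] at h2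
  rw [← Ideal.mem_span_singleton, ← PadicInt.maximalIdeal_eq_span_p, ← PadicInt.ker_toZMod,
    RingHom.mem_ker, map_sub, sub_eq_zero]
  exact h2

lemma coeff_one_coeff_colemanNorm [Fact p.Prime] [CharP R p] (a b : R[X]) (j : ℕ) :
    ((colemanNorm p (a.map C + C (X : R[X]) * b.map C)).coeff j).coeff 1 = 0 := by
  have hp : p.Prime := Fact.out
  have h := expand_colemanNorm (R := R[X]) (p := p) (a.map C + C (X : R[X]) * b.map C)
  rw [add_pow_char, mul_pow, ← C_pow, ← Polynomial.map_pow, ← Polynomial.map_pow] at h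
  have h2 := congrArg (fun f => (f.coeff (j * p)).coeff 1) h
  simp only [coeff_expand_mul hp.pos] at h2
  rw [h2]
  rw [coeff_add, coeff_add, coeff_C_mul, coeff_map, coeff_map, coeff_C, X_pow_mul,
    coeff_mul_X_pow']
  simp [hp.one_lt.not_ge]

lemma dvd_coeff_colemanNorm_sub_of_dvd [Fact p.Prime] {a b : ℤ_[p][X]} {i : ℕ} (hi : i ≠ 0)
    (h : ∀ j, (p : ℤ_[p]) ^ i ∣ a.coeff j - b.coeff j) (j : ℕ) :
    (p : ℤ_[p]) ^ (i + 1) ∣ (colemanNorm p a).coeff j - (colemanNorm p b).coeff j := by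
  have hp : p ≠ 0 := (Fact.out : p.Prime).ne_zero
  obtain ⟨c, hc⟩ : C ((p : ℤ_[p]) ^ i) ∣ a - b := by
    rw [C_dvd_iff_dvd_coeff]
    simpa using h
  set G : ℤ_[p][X][X] := b.map C + C X * c.map C with hG
  have hev (t : ℤ_[p]) : (colemanNorm p G).map (evalRingHom t) = colemanNorm p (b + C t * c) := by
    rw [← colemanNorm_map hp]
    congr 1
    simp only [hG, Polynomial.map_add, Polynomial.map_mul, map_C, Polynomial.map_map]
    have : (evalRingHom t).comp C = RingHom.id ℤ_[p] := by ext; simp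
    simp [this]
  set f := (colemanNorm p G).coeff j with hf
  have hevj (t : ℤ_[p]) : f.eval t = (colemanNorm p (b + C t * c)).coeff j := by
    rw [← hev]; simp [hf]
  have h1 : (p : ℤ_[p]) ∣ f.coeff 1 := by
    have := coeff_one_coeff_colemanNorm (R := ZMod p) (p := p)
      (b.map PadicInt.toZMod) (c.map PadicInt.toZMod) j
    rw [← Ideal.mem_span_singleton, ← PadicInt.maximalIdeal_eq_span_p, ← PadicInt.ker_toZMod,
      RingHom.mem_ker]
    have h3 : (b.map PadicInt.toZMod).map C + C X * (c.map PadicInt.toZMod).map C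
        = G.map (mapRingHom (PadicInt.toZMod (p := p))) := by
      simp only [hG, Polynomial.map_add, Polynomial.map_mul, map_C, Polynomial.map_map]
      have : (C : ZMod p →+* _).comp (PadicInt.toZMod (p := p))
        = (mapRingHom (PadicInt.toZMod (p := p))).comp C := by ext; simp
      simp [this]
    rw [h3, colemanNorm_map hp] at this
    simpa [hf] using this
  obtain ⟨k, hk⟩ := f.binomExpansion 0 ((p : ℤ_[p]) ^ i)
  have ha : a = b + C ((p : ℤ_[p]) ^ i) * c := by rw [← hc]; ring
  have hb : (colemanNorm p b).coeff j = f.eval 0 := by simp [hevj]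
  rw [ha, ← hevj, hb]
  rw [zero_add] at hk
  rw [hk]
  obtain ⟨d, hd⟩ := h1
  have hder : f.derivative.eval 0 = f.coeff 1 := by
    rw [← coeff_zero_eq_eval_zero, coeff_derivative]; simp
  rw [hder, hd]
  obtain ⟨i, rfl⟩ := Nat.exists_eq_succ_of_ne_zero hi
  exact ⟨d + k * p ^ i, by simp only [Nat.succ_eq_add_one]; ring⟩

lemma dvd_coeff_colemanNorm_iterate_sub [Fact p.Prime] (g : ℤ_[p][X]) (m j : ℕ) :
    (p : ℤ_[p]) ^ (m + 1) ∣
      ((colemanNorm p)^[m + 1] g).coeff j - ((colemanNorm p)^[m] g).coeff j := by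
  induction m generalizing j with
  | zero => simpa using dvd_coeff_colemanNorm_sub g j
  | succ m ih =>
    rw [Function.iterate_succ_apply' _ (m + 1)]
    nth_rw 2 [Function.iterate_succ_apply']
    generalize (colemanNorm p)^[m + 1] g = a at ih ⊢
    generalize (colemanNorm p)^[m] g = b at ih ⊢
    exact dvd_coeff_colemanNorm_sub_of_dvd m.succ_ne_zero ih j

lemma dvd_eval_colemanNorm_iterate_sub [Fact p.Prime] (g : ℤ_[p][X]) (m : ℕ) (x : ℤ_[p]) :
    (p : ℤ_[p]) ^ (m + 1) ∣
      ((colemanNorm p)^[m + 1] g).eval x - ((colemanNorm p)^[m] g).eval x := by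
  have : C ((p : ℤ_[p]) ^ (m + 1)) ∣ (colemanNorm p)^[m + 1] g - (colemanNorm p)^[m] g := by
    rw [C_dvd_iff_dvd_coeff]
    simpa using dvd_coeff_colemanNorm_iterate_sub g m
  obtain ⟨c, hc⟩ := this
  rw [← eval_sub, hc]
  simp

lemma dvd_eval_colemanNorm_iterate_sub_eval [Fact p.Prime] (g : ℤ_[p][X]) (m : ℕ) (x : ℤ_[p]) :
    (p : ℤ_[p]) ∣ ((colemanNorm p)^[m] g).eval x - g.eval x := by
  induction m with
  | zero => simp
  | succ m ih =>
    rw [← sub_add_sub_cancel]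
    exact dvd_add ((dvd_pow_self _ (Nat.succ_ne_zero m)).trans
      (dvd_eval_colemanNorm_iterate_sub g m x)) ih

lemma prod_nthRootsFinset_colemanNorm {K : Type*} [Field K] [CharZero K] [IsAlgClosed K]
    [Fact p.Prime] {N : ℕ} (hN : N ≠ 0) (g : K[X]) :
    ∏ ξ ∈ nthRootsFinset N (1 : K), (colemanNorm p g).eval ξ
      = ∏ ξ ∈ nthRootsFinset (p * N) (1 : K), g.eval ξ := by
  classical
  have hp : p ≠ 0 := (Fact.out : p.Prime).ne_zero
  have hmem (ξ : K) (h : ξ ∈ nthRootsFinset (p * N) (1 : K)) :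
      ξ ^ p ∈ nthRootsFinset N (1 : K) := by
    rw [mem_nthRootsFinset (by positivity)] at h ⊢
    rw [← pow_mul, h]
  rw [← Finset.prod_fiberwise_of_maps_to hmem]
  refine Finset.prod_congr rfl fun ξ hξ => ?_
  rw [mem_nthRootsFinset (by positivity)] at hξ
  have hξ0 : ξ ≠ 0 := by rintro rfl; simp [hN] at hξ
  rw [eval_colemanNorm_eq_prod_nthRoots hp _ _ (IsAlgClosed.splits _)]
  have hnd : (nthRoots p ξ).Nodup := by
    apply nodup_roots
    exact separable_X_pow_sub_C ξ (Nat.cast_ne_zero.mpr hp) hξ0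
  change _ = (Multiset.map _ _).prod
  congr 2
  rw [← Multiset.toFinset_val (nthRoots p ξ) |>.trans hnd.dedup] 
  congr 1
  ext η
  simp only [Multiset.mem_toFinset, mem_nthRoots (Nat.pos_of_ne_zero hp), Finset.mem_filter,
    mem_nthRootsFinset (show 0 < p * N by positivity)]
  exact ⟨fun h => ⟨by rw [pow_mul, h, hξ], h⟩, fun h => h.2⟩

lemma eval_one_colemanNorm_iterate {K : Type*} [Field K] [CharZero K] [IsAlgClosed K]
    [Fact p.Prime] (m : ℕ) (g : K[X]) :
    ((colemanNorm p)^[m] g).eval 1 = ∏ ξ ∈ nthRootsFinset (p ^ m) (1 : K), g.eval ξ := by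
  induction m generalizing g with
  | zero =>
    have h : nthRootsFinset 1 (1 : K) = {1} := by ext; simp [mem_nthRootsFinset]
    simp [h]
  | succ m ih =>
    rw [Function.iterate_succ_apply, ih, pow_succ',
      prod_nthRootsFinset_colemanNorm (pow_ne_zero _ (Fact.out : p.Prime).ne_zero)]

end ColemanNorm

section CyclotomicNorm

variable {p : ℕ} [Fact p.Prime]

lemma irreducible_cyclotomic_prime_pow_padic (m : ℕ) :
    Irreducible (cyclotomic (p ^ (m + 1)) ℚ_[p]) := by
  have hprime : (Ideal.span {(p : ℤ_[p])}).IsPrime := by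
    rw [← PadicInt.maximalIdeal_eq_span_p]
    infer_instance
  have hmon : ((cyclotomic (p ^ (m + 1)) ℤ_[p]).comp (X + 1)).Monic := by
    rw [← C_1]
    exact (cyclotomic.monic _ _).comp_X_add_C 1
  have hmap : (cyclotomic (p ^ (m + 1)) ℤ_[p]).comp (X + 1)
      = ((cyclotomic (p ^ (m + 1)) ℤ).comp (X + 1)).map (Int.castRingHom ℤ_[p]) := by
    simp [Polynomial.map_comp]
  have heis := cyclotomic_prime_pow_comp_X_add_one_isEisensteinAt p m
  have hmonZ : ((cyclotomic (p ^ (m + 1)) ℤ).comp (X + 1)).Monic := by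
    rw [← C_1]
    exact (cyclotomic.monic _ _).comp_X_add_C 1
  have hE : ((cyclotomic (p ^ (m + 1)) ℤ_[p]).comp (X + 1)).IsEisensteinAt
      (Ideal.span {(p : ℤ_[p])}) := by
    refine hmon.isEisensteinAt_of_mem_of_notMem hprime.ne_top (fun {i} hi => ?_) ?_
    · rw [hmap, hmonZ.natDegree_map] at hi
      have := heis.coeff_mem hi.ne
      rw [Submodule.mem_span_singleton] at this
      obtain ⟨c, hc⟩ := this
      rw [hmap, coeff_map, ← hc, Ideal.mem_span_singleton]
      exact ⟨c, by simp [mul_comm]⟩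
    · rw [coeff_zero_eq_eval_zero, eval_comp]
      simp only [eval_add, eval_X, eval_one, zero_add, eval_one_cyclotomic_prime_pow]
      rw [Ideal.span_singleton_pow, Ideal.mem_span_singleton]
      intro h
      have h1 := (pow_dvd_pow_iff (PadicInt.prime_p (p := p)).ne_zero
        PadicInt.prime_p.not_isUnit).mp ((pow_one (p : ℤ_[p])).symm ▸ h : (p : ℤ_[p]) ^ 2 ∣ p ^ 1)
      omega
  have h1 := hE.irreducible hprime hmon.isPrimitive (by
    rw [hmap, hmonZ.natDegree_map]
    exact Nat.pos_of_ne_zero fun h0 => by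
      rw [natDegree_comp, natDegree_cyclotomic, ← C_1, natDegree_X_add_C, mul_one] at h0
      exact (Nat.totient_pos.mpr (pow_pos (Fact.out : p.Prime).pos _)).ne' h0)
  rw [hmon.irreducible_iff_irreducible_map_fraction_map (K := ℚ_[p])] at h1
  have h2 : ((cyclotomic (p ^ (m + 1)) ℤ_[p]).comp (X + 1)).map (algebraMap ℤ_[p] ℚ_[p])
      = algEquivAevalXAddC 1 (cyclotomic (p ^ (m + 1)) ℚ_[p]) := by
    rw [algEquivAevalXAddC_apply, ← comp_eq_aeval, Polynomial.map_comp]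
    simp
  rw [h2] at h1
  exact (MulEquiv.irreducible_iff (algEquivAevalXAddC (1 : ℚ_[p]))).mp h1

variable {L : Type*} [Field L] [Algebra ℚ_[p] L] {m : ℕ} {y : L}

lemma algebraMap_norm_aeval_eq_prod [IsCyclotomicExtension {p ^ (m + 1)} ℚ_[p] L]
    (hy : IsPrimitiveRoot y (p ^ (m + 1))) (g : ℚ_[p][X]) :
    algebraMap ℚ_[p] (AlgebraicClosure ℚ_[p]) (Algebra.norm ℚ_[p] (aeval y g))
      = ∏ ξ ∈ primitiveRoots (p ^ (m + 1)) (AlgebraicClosure ℚ_[p]), aeval ξ g := by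
  have : NeZero (p ^ (m + 1)) := ⟨pow_ne_zero _ (Fact.out : p.Prime).ne_zero⟩
  have : FiniteDimensional ℚ_[p] L := IsCyclotomicExtension.finiteDimensional {p ^ (m + 1)} _ _
  rw [Algebra.norm_eq_prod_embeddings, ← Finset.prod_coe_sort (primitiveRoots _ _)]
  refine Fintype.prod_equiv (M := AlgebraicClosure ℚ_[p]) (hy.embeddingsEquivPrimitiveRoots (AlgebraicClosure ℚ_[p])
    (irreducible_cyclotomic_prime_pow_padic m)) _ _ fun σ => ?_
  rw [hy.embeddingsEquivPrimitiveRoots_apply_coe]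
  exact (aeval_algHom_apply σ y g).symm

lemma nthRootsFinset_prime_pow_succ {K : Type*} [CommRing K] [IsDomain K] [DecidableEq K] (m : ℕ) :
    nthRootsFinset (p ^ (m + 1)) (1 : K)
      = (primitiveRoots (p ^ (m + 1)) K).disjUnion (nthRootsFinset (p ^ m) (1 : K)) (by
        have hp : p.Prime := Fact.out
        rw [Finset.disjoint_left]
        intro ξ h1 h2
        rw [mem_nthRootsFinset (pow_pos hp.pos _)] at h2
        rw [mem_primitiveRoots (pow_pos hp.pos _)] at h1
        have := Nat.le_of_dvd (pow_pos hp.pos _) (h1.dvd_of_pow_eq_one _ h2)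
        exact (Nat.pow_lt_pow_right hp.one_lt m.lt_succ_self).not_ge this) := by
  have hp : p.Prime := Fact.out
  ext ξ
  rw [Finset.mem_disjUnion, mem_nthRootsFinset (pow_pos hp.pos _),
    mem_nthRootsFinset (pow_pos hp.pos _), mem_primitiveRoots (pow_pos hp.pos _)]
  constructor
  · intro h
    by_cases h1 : ξ ^ p ^ m = 1
    · exact Or.inr h1
    · left
      rw [← orderOf_eq_prime_pow h1 h]
      exact IsPrimitiveRoot.orderOf ξ
  · rintro (h | h)
    · exact h.pow_eq_one
    · rw [pow_succ, pow_mul, h, one_pow]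

lemma norm_aeval_mul_eval_colemanNorm [IsCyclotomicExtension {p ^ (m + 1)} ℚ_[p] L]
    (hy : IsPrimitiveRoot y (p ^ (m + 1))) (g : ℤ_[p][X]) :
    Algebra.norm ℚ_[p] (aeval y (g.map (algebraMap ℤ_[p] ℚ_[p])))
      * (((colemanNorm p)^[m] g).eval 1 : ℤ_[p])
      = (((colemanNorm p)^[m + 1] g).eval 1 : ℤ_[p]) := by
  classical
  let φ : ℤ_[p] →+* AlgebraicClosure ℚ_[p] :=
    (algebraMap ℚ_[p] (AlgebraicClosure ℚ_[p])).comp (algebraMap ℤ_[p] ℚ_[p])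
  have hp : p ≠ 0 := (Fact.out : p.Prime).ne_zero
  have hiter (j : ℕ) : ((colemanNorm p)^[j] g).map φ = (colemanNorm p)^[j] (g.map φ) := by
    induction j with
    | zero => rfl
    | succ j ih =>
      rw [Function.iterate_succ_apply', Function.iterate_succ_apply', ← ih]
      exact (colemanNorm_map hp φ _).symm
  have key (j : ℕ) : algebraMap ℚ_[p] (AlgebraicClosure ℚ_[p])
      (((colemanNorm p)^[j] g).eval 1 : ℤ_[p])
        = ∏ ξ ∈ nthRootsFinset (p ^ j) (1 : AlgebraicClosure ℚ_[p]), (g.map φ).eval ξ := by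
    rw [← eval_one_colemanNorm_iterate, ← hiter, eval_one_map]
    rfl
  apply (algebraMap ℚ_[p] (AlgebraicClosure ℚ_[p])).injective
  rw [map_mul, key, key, algebraMap_norm_aeval_eq_prod hy, nthRootsFinset_prime_pow_succ,
    Finset.prod_disjUnion]
  congr 1
  refine Finset.prod_congr rfl fun ξ _ => ?_
  rw [aeval_def, ← eval_map, Polynomial.map_map]

lemma exists_norm_aeval_of_isUnit [IsCyclotomicExtension {p ^ (m + 1)} ℚ_[p] L]
    (hy : IsPrimitiveRoot y (p ^ (m + 1))) (g : ℤ_[p][X]) (hg : IsUnit (g.eval 1)) :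
    ∃ w : ℤ_[p], Algebra.norm ℚ_[p] (aeval y (g.map (algebraMap ℤ_[p] ℚ_[p])))
      = ((1 + p ^ (m + 1) * w : ℤ_[p]) : ℚ_[p]) := by
  have h1 := norm_aeval_mul_eval_colemanNorm hy g
  obtain ⟨c, hc⟩ := dvd_eval_colemanNorm_iterate_sub g m 1
  obtain ⟨d, hd⟩ := dvd_eval_colemanNorm_iterate_sub_eval g m 1
  generalize ((colemanNorm p)^[m] g).eval 1 = a at *
  generalize ((colemanNorm p)^[m + 1] g).eval 1 = b at *
  have ha : IsUnit a := by
    by_contra h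
    have h2 : (p : ℤ_[p]) ∣ a := by
      rwa [← PadicInt.norm_lt_one_iff_dvd, ← PadicInt.mem_nonunits]
    have h3 : (p : ℤ_[p]) ∣ g.eval 1 := (dvd_sub_right h2).mp ⟨d, hd⟩
    exact PadicInt.prime_p.not_isUnit (isUnit_of_dvd_unit h3 hg)
  obtain ⟨a, rfl⟩ := ha
  refine ⟨c * (a⁻¹ : ℤ_[p]ˣ), ?_⟩
  have ha0 : ((a : ℤ_[p]) : ℚ_[p]) ≠ 0 := by simp
  apply mul_right_cancel₀ ha0
  rw [h1, ← PadicInt.coe_mul]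
  congr 1
  have : b = a + p ^ (m + 1) * c := by rw [← hc]; ring
  rw [this, add_mul, one_mul, mul_assoc, mul_assoc, Units.inv_mul, mul_one]

lemma exists_norm_aeval [IsCyclotomicExtension {p ^ (m + 1)} ℚ_[p] L] (hp2 : p ≠ 2)
    (hy : IsPrimitiveRoot y (p ^ (m + 1))) (g : ℤ_[p][X])
    (hg : aeval y (g.map (algebraMap ℤ_[p] ℚ_[p])) ≠ 0) :
    ∃ (r : ℕ) (w : ℤ_[p]), Algebra.norm ℚ_[p] (aeval y (g.map (algebraMap ℤ_[p] ℚ_[p])))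
      = p ^ r * ((1 + p ^ (m + 1) * w : ℤ_[p]) : ℚ_[p]) := by
  have hp : p.Prime := Fact.out
  have : NeZero (p ^ (m + 1)) := ⟨pow_ne_zero _ hp.ne_zero⟩
  have : FiniteDimensional ℚ_[p] L := IsCyclotomicExtension.finiteDimensional {p ^ (m + 1)} _ _
  let : Algebra ℤ_[p] L := ((algebraMap ℚ_[p] L).comp (algebraMap ℤ_[p] ℚ_[p])).toAlgebra
  have : IsScalarTower ℤ_[p] ℚ_[p] L := IsScalarTower.of_algebraMap_eq fun _ => rfl
  have hyint : IsIntegral ℤ_[p] y := (hy.isIntegral (pow_pos hp.pos _)).tower_top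
  simp only [aeval_map_algebraMap] at hg ⊢
  have hintegral (g : ℤ_[p][X]) : ∃ z : ℤ_[p], (z : ℚ_[p]) = Algebra.norm ℚ_[p] (aeval y g) := by
    have h : IsIntegral ℤ_[p] (Algebra.norm ℚ_[p] (aeval y g)) :=
      Algebra.isIntegral_norm _ (adjoin_le_integralClosure hyint (aeval_mem_adjoin_singleton ℤ_[p] y))
    exact IsIntegrallyClosed.isIntegral_iff.mp h
  obtain ⟨z, hz⟩ := hintegral g
  induction hN : z.valuation using Nat.strong_induction_on generalizing g z with
  | _ N ih =>
  by_cases hu : IsUnit (g.eval 1)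
  · obtain ⟨w, hw⟩ := exists_norm_aeval_of_isUnit hy g hu
    exact ⟨0, w, by simpa [aeval_map_algebraMap] using hw⟩
  · obtain ⟨c, hc⟩ : (p : ℤ_[p]) ∣ g.eval 1 := by
      rwa [← PadicInt.norm_lt_one_iff_dvd, ← PadicInt.mem_nonunits]
    set Φ := cyclotomic (p ^ (m + 1)) ℤ_[p] with hΦ
    have h0 : (g - C c * Φ).IsRoot 1 := by
      simp [hΦ, eval_one_cyclotomic_prime_pow, hc, mul_comm]
    obtain ⟨h, hh⟩ := dvd_iff_isRoot.mpr h0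
    have hΦy : aeval y Φ = 0 := by
      rw [hΦ, aeval_def, ← eval_map, map_cyclotomic]
      exact hy.isRoot_cyclotomic (pow_pos hp.pos _)
    have hgy : aeval y g = (y - 1) * aeval y h := by
      have := congrArg (aeval y) hh
      simpa [hΦy] using this
    have hny : Algebra.norm ℚ_[p] (y - 1) = p :=
      hy.norm_sub_one_of_prime_ne_two (irreducible_cyclotomic_prime_pow_padic m) hp2
    obtain ⟨t, ht⟩ := hintegral h
    have hh0 : aeval y h ≠ 0 := right_ne_zero_of_mul (hgy ▸ hg)
    have hzt : z = p * t := by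
      apply Subtype.coe_injective
      change (z : ℚ_[p]) = ((p * t : ℤ_[p]) : ℚ_[p])
      rw [hz, hgy, map_mul, hny, ← ht]
      simp
    have ht0 : t ≠ 0 := by
      rintro rfl
      exact hh0 (Algebra.norm_eq_zero_iff.mp (by rw [← ht]; rfl))
    have hval : t.valuation < N := by
      rw [← hN, hzt, PadicInt.valuation_mul (by exact_mod_cast hp.ne_zero) ht0,
        PadicInt.valuation_p]
      omega
    obtain ⟨r, w, hw⟩ := ih _ hval h hh0 t ht rfl
    exact ⟨r + 1, w, by rw [hgy, map_mul, hny, hw]; ring⟩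

theorem exists_norm_eq_zpow_mul [IsCyclotomicExtension {p ^ (m + 1)} ℚ_[p] L] (hp2 : p ≠ 2)
    {a : L} (ha : a ≠ 0) :
    ∃ (r : ℤ) (w : ℤ_[p]), Algebra.norm ℚ_[p] a
      = (p : ℚ_[p]) ^ r * ((1 + p ^ (m + 1) * w : ℤ_[p]) : ℚ_[p]) := by
  have hp : p.Prime := Fact.out
  have hp0 : (p : ℚ_[p]) ≠ 0 := by exact_mod_cast hp.ne_zero
  have : NeZero (p ^ (m + 1)) := ⟨pow_ne_zero _ hp.ne_zero⟩
  have : FiniteDimensional ℚ_[p] L := IsCyclotomicExtension.finiteDimensional {p ^ (m + 1)} _ _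
  have hy := IsCyclotomicExtension.zeta_spec (p ^ (m + 1)) ℚ_[p] L
  set y := IsCyclotomicExtension.zeta (p ^ (m + 1)) ℚ_[p] L
  obtain ⟨f, rfl⟩ : ∃ f : ℚ_[p][X], aeval y f = a := by
    have : a ∈ Algebra.adjoin ℚ_[p] {y} := by
      rw [IsCyclotomicExtension.adjoin_primitive_root_eq_top hy]
      trivial
    rwa [Algebra.adjoin_singleton_eq_range_aeval] at this
  obtain ⟨b, hb, hbf⟩ := IsLocalization.integerNormalization_spec (nonZeroDivisors ℤ_[p]) f
  have hb0 : b ≠ 0 := nonZeroDivisors.ne_zero hb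
  set g := C ((PadicInt.unitCoeff hb0)⁻¹ : ℤ_[p]ˣ).val *
    IsLocalization.integerNormalization (nonZeroDivisors ℤ_[p]) f with hg
  have hgf : g.map (algebraMap ℤ_[p] ℚ_[p]) = C ((p : ℚ_[p]) ^ b.valuation) * f := by
    rw [hg, Polynomial.map_mul, hbf, map_C, ← IsScalarTower.algebraMap_smul ℚ_[p] b f,
      smul_eq_C_mul, ← mul_assoc, ← C_mul, ← map_mul]
    nth_rw 2 [PadicInt.unitCoeff_spec hb0]
    rw [← mul_assoc, Units.inv_mul]
    simp
  have hga : aeval y (g.map (algebraMap ℤ_[p] ℚ_[p]))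
      = algebraMap ℚ_[p] L ((p : ℚ_[p]) ^ b.valuation) * aeval y f := by
    rw [hgf, map_mul, aeval_C]
  obtain ⟨r, w, hw⟩ := exists_norm_aeval hp2 hy g (by
    rw [hga]
    exact mul_ne_zero (by rw [_root_.map_ne_zero]; exact pow_ne_zero _ hp0) ha)
  refine ⟨r - (b.valuation * Module.finrank ℚ_[p] L : ℕ), w, ?_⟩
  rw [hga, map_mul, Algebra.norm_algebraMap, ← pow_mul] at hw
  rw [zpow_sub₀ hp0, zpow_natCast, zpow_natCast, div_mul_eq_mul_div, eq_div_iff (pow_ne_zero _ hp0),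
    ← hw, mul_comm]

end CyclotomicNorm

section AddValuation

variable {F : Type*} [Field F] {v : AddValuation F (WithTop ℤ)}

lemma AddValuation.exists_eq_coe {x : F} (hx : x ≠ 0) : ∃ k : ℤ, v x = k := by
  obtain ⟨k, hk⟩ := WithTop.ne_top_iff_exists.mp ((v.ne_top_iff).mpr hx)
  exact ⟨k, hk.symm⟩

lemma AddValuation.map_pow_eq_coe {x : F} {k : ℤ} (h : v x = k) (n : ℕ) :
    v (x ^ n) = ((n * k : ℤ) : WithTop ℤ) := by
  rw [v.map_pow, h, ← WithTop.coe_nsmul, nsmul_eq_mul]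

lemma AddValuation.map_mul_eq_coe {x y : F} {k l : ℤ} (hx : v x = k) (hy : v y = l) :
    v (x * y) = ((k + l : ℤ) : WithTop ℤ) := by
  rw [v.map_mul, hx, hy, WithTop.coe_add]

lemma AddValuation.le_map_mul {x y : F} {k l : ℤ} (hx : (k : WithTop ℤ) ≤ v x)
    (hy : (l : WithTop ℤ) ≤ v y) : ((k + l : ℤ) : WithTop ℤ) ≤ v (x * y) := by
  rw [v.map_mul, WithTop.coe_add]
  exact add_le_add hx hy

lemma AddValuation.map_inv_eq_coe {x : F} {k : ℤ} (h : v x = k) : v x⁻¹ = ((-k : ℤ) : WithTop ℤ) := by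
  have hx : x ≠ 0 := v.ne_top_iff.mp (by rw [h]; exact WithTop.coe_ne_top)
  obtain ⟨l, hl⟩ := AddValuation.exists_eq_coe (v := v) (inv_ne_zero hx)
  have := AddValuation.map_mul_eq_coe h hl
  rw [mul_inv_cancel₀ hx, v.map_one, ← WithTop.coe_zero, WithTop.coe_inj] at this
  rw [hl, WithTop.coe_inj]
  omega

lemma AddValuation.natCast_nonneg (n : ℕ) : 0 ≤ v (n : F) := by
  induction n with
  | zero => simp
  | succ n ih =>
    rw [Nat.cast_succ]
    exact v.map_le_add ih (by simp)

lemma AddValuation.map_pow_nonneg {x : F} (hx : 0 ≤ v x) (n : ℕ) : 0 ≤ v (x ^ n) := by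
  rw [v.map_pow]
  exact nsmul_nonneg hx n

lemma AddValuation.le_map_mul_of_nonneg_right {x y : F} {k : WithTop ℤ} (hx : k ≤ v x)
    (hy : 0 ≤ v y) : k ≤ v (x * y) := by
  rw [v.map_mul]
  exact le_add_of_le_of_nonneg hx hy

lemma AddValuation.le_map_pow_sub_pow {x y : F} (hx : 0 ≤ v x) (hy : 0 ≤ v y) (n : ℕ) :
    v (x - y) ≤ v (x ^ n - y ^ n) := by
  rw [← (Commute.all x y).mul_geom_sum₂]
  refine AddValuation.le_map_mul_of_nonneg_right le_rfl (v.map_le_sum fun i _ => ?_)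
  exact AddValuation.le_map_mul_of_nonneg_right (AddValuation.map_pow_nonneg hx _)
    (AddValuation.map_pow_nonneg hy _)

lemma AddValuation.eq_zero_of_forall_natCast_le {x : F}
    (h : ∀ k : ℕ, ((k : ℤ) : WithTop ℤ) ≤ v x) : x = 0 := by
  by_contra hx
  obtain ⟨t, ht⟩ := AddValuation.exists_eq_coe (v := v) hx
  have := h (t.toNat + 1)
  rw [ht, WithTop.coe_le_coe] at this
  omega

lemma AddValuation.nonneg_of_le_map_sub_one {x : F} {b : ℤ} (hb : 0 ≤ b)
    (h : (b : WithTop ℤ) ≤ v (x - 1)) : 0 ≤ v x := by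
  rw [← sub_add_cancel x 1]
  refine v.map_le_add (le_trans ?_ h) (by simp)
  exact_mod_cast hb

variable {p : ℕ} [Fact p.Prime] {e : ℤ}

lemma le_map_mul_sub_add_pow_sub_pow (hvp : v (p : F) = e) {w ε : F} {a : ℤ} (ha : 1 ≤ a)
    (hae : e < (p - 1) * a) (hw : 1 ≤ v (w - 1)) (hε : (a : WithTop ℤ) ≤ v ε) :
    ((e + a + 1 : ℤ) : WithTop ℤ) ≤ v (p * ε - ((w + ε) ^ p - w ^ p)) := by
  have hp : p.Prime := Fact.out
  have hw0 : 0 ≤ v w := AddValuation.nonneg_of_le_map_sub_one (b := 1) zero_le_one hw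
  obtain ⟨q, hq⟩ : ∃ q, p = q + 1 := ⟨p - 1, (Nat.sub_add_cancel hp.one_le).symm⟩
  have key : p * ε - ((w + ε) ^ p - w ^ p) = p * (ε * (1 - w ^ q)) -
      ∑ i ∈ Finset.range q, w ^ i * ε ^ (p - i) * (p.choose i : F) := by
    rw [add_pow, Finset.sum_range_succ, hq, Finset.sum_range_succ]
    simp
    ring
  rw [key]
  have hpow (k : ℕ) : ((k * a : ℤ) : WithTop ℤ) ≤ v (ε ^ k) := by
    rw [v.map_pow, ← nsmul_eq_mul, WithTop.coe_nsmul]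
    exact nsmul_le_nsmul_right hε k
  refine v.map_le_sub ?_ (v.map_le_sum fun i hi => ?_)
  · rw [add_assoc]
    refine AddValuation.le_map_mul hvp.ge (AddValuation.le_map_mul hε ?_)
    refine hw.trans ?_
    rw [v.map_sub_swap 1]
    simpa using AddValuation.le_map_pow_sub_pow hw0 (v.map_one.ge) q
  · rw [Finset.mem_range] at hi
    rw [mul_assoc]
    rw [mul_comm]
    refine AddValuation.le_map_mul_of_nonneg_right ?_ (AddValuation.map_pow_nonneg hw0 i)
    rcases Nat.eq_zero_or_pos i with rfl | hi0
    · simp only [Nat.sub_zero, Nat.choose_zero_right, Nat.cast_one, mul_one]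
      refine le_trans ?_ (hpow p)
      rw [WithTop.coe_le_coe]
      linarith
    · obtain ⟨c, hc⟩ := hp.dvd_choose_self hi0.ne' (by omega)
      rw [hc, Nat.cast_mul, mul_comm, mul_assoc, add_assoc]
      refine AddValuation.le_map_mul hvp.ge ?_
      rw [mul_comm]
      refine AddValuation.le_map_mul_of_nonneg_right (le_trans ?_ (hpow (p - i)))
        (AddValuation.natCast_nonneg c)
      rw [WithTop.coe_le_coe, Nat.cast_sub (by omega)]
      have : (i : ℤ) + 2 ≤ p := by exact_mod_cast (by omega : i + 2 ≤ p)
      nlinarith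

lemma exists_pow_eq_one_add_mul (x : ℤ_[p]) {l : ℕ} (hl : l.Prime) (hlp : l ≠ p) :
    ∃ s : ℤ_[p], s ^ l = 1 + p * x := by
  have hnl : ‖(l : ℤ_[p])‖ = 1 := by
    rw [PadicInt.norm_natCast_eq_one_iff, Nat.coprime_primes Fact.out hl]
    exact hlp.symm
  obtain ⟨s, hs, -⟩ := hensels_lemma (p := p) (R := ℤ_[p]) (F := X ^ l - C (1 + p * x)) (a := 1) (by
    have h1 : aeval 1 (derivative (X ^ l - C (1 + p * x) : ℤ_[p][X])) = (l : ℤ_[p]) := by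
      simp [derivative_X_pow]
    have h2 : aeval 1 (X ^ l - C (1 + p * x) : ℤ_[p][X]) = -(p * x) := by simp
    rw [h1, h2, hnl, norm_neg, one_pow, PadicInt.norm_lt_one_iff_dvd]
    exact dvd_mul_right _ _)
  exact ⟨s, by simpa [sub_eq_zero] using hs⟩

variable [Algebra ℚ_[p] F]

lemma map_padicInt_nonneg (he : 0 < e) (hvp : v (p : F) = e) (x : ℤ_[p]) :
    0 ≤ v (algebraMap ℚ_[p] F x) := by
  have h1 (x : ℤ_[p]) : 0 ≤ v (algebraMap ℚ_[p] F ((p * x : ℤ_[p]) : ℚ_[p])) := by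
    by_contra! hneg
    have hne : algebraMap ℚ_[p] F ((p * x : ℤ_[p]) : ℚ_[p]) ≠ 0 := by
      intro h
      rw [h, v.map_zero] at hneg
      exact absurd hneg (by simp)
    obtain ⟨t, ht⟩ := AddValuation.exists_eq_coe (v := v) hne
    have ht0 : t < 0 := by
      rw [ht] at hneg
      exact_mod_cast hneg
    obtain ⟨l, hl, hlp⟩ := Nat.exists_infinite_primes (p + t.natAbs + 1)
    obtain ⟨s, hs⟩ := exists_pow_eq_one_add_mul x hlp (by omega)
    have h2 : v (algebraMap ℚ_[p] F s ^ l) = t := by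
      rw [← ht, ← map_pow, ← PadicInt.coe_pow, hs, PadicInt.coe_add, map_add, PadicInt.coe_one,
        map_one]
      exact v.map_add_eq_of_lt_right (by rw [v.map_one]; exact hneg)
    have hs0 : algebraMap ℚ_[p] F s ≠ 0 := by
      intro h
      rw [h, zero_pow hlp.ne_zero, v.map_zero] at h2
      exact absurd h2 (by simp)
    obtain ⟨k, hk⟩ := AddValuation.exists_eq_coe (v := v) hs0
    rw [AddValuation.map_pow_eq_coe hk, WithTop.coe_inj] at h2
    have hk0 : k < 0 := by
      by_contra! hk0
      have : 0 ≤ (l : ℤ) * k := by positivity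
      omega
    have : (l : ℤ) * k ≤ -l := by nlinarith [(Nat.cast_nonneg l : (0 : ℤ) ≤ l)]
    omega
  by_contra! hneg
  have hne : algebraMap ℚ_[p] F x ≠ 0 := by
    intro h
    rw [h, v.map_zero] at hneg
    exact absurd hneg (by simp)
  obtain ⟨t, ht⟩ := AddValuation.exists_eq_coe (v := v) hne
  have ht0 : t < 0 := by
    rw [ht] at hneg
    exact_mod_cast hneg
  have h2 := h1 (x ^ (e.natAbs + 1))
  rw [PadicInt.coe_mul, PadicInt.coe_pow, map_mul, map_pow, PadicInt.coe_natCast, map_natCast,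
    AddValuation.map_mul_eq_coe hvp (AddValuation.map_pow_eq_coe ht _), ← WithTop.coe_zero,
    WithTop.coe_le_coe] at h2
  push_cast at h2
  rw [abs_of_pos he] at h2
  nlinarith

lemma map_padicInt_eq_zero_of_isUnit (he : 0 < e) (hvp : v (p : F) = e) {x : ℤ_[p]} (hx : IsUnit x) :
    v (algebraMap ℚ_[p] F x) = 0 := by
  obtain ⟨x, rfl⟩ := hx
  have h1 := map_padicInt_nonneg he hvp x
  have h2 := map_padicInt_nonneg he hvp (x⁻¹ : ℤ_[p]ˣ)
  have h3 : v (algebraMap ℚ_[p] F (x : ℤ_[p]) * algebraMap ℚ_[p] F ((x⁻¹ : ℤ_[p]ˣ) : ℤ_[p])) = 0 := by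
    rw [← map_mul, ← PadicInt.coe_mul, Units.mul_inv]
    simp
  rw [v.map_mul] at h3
  refine le_antisymm ?_ h1
  calc v (algebraMap ℚ_[p] F (x : ℤ_[p])) ≤ _ := le_add_of_nonneg_right h2
    _ = 0 := h3

lemma map_padic_eq (he : 0 < e) (hvp : v (p : F) = e) {x : ℚ_[p]} (hx : x ≠ 0) :
    v (algebraMap ℚ_[p] F x) = ((e * x.valuation : ℤ) : WithTop ℤ) := by
  have hp0 : (p : ℚ_[p]) ≠ 0 := by exact_mod_cast (Fact.out : p.Prime).ne_zero
  have hnorm : ‖x * (p : ℚ_[p]) ^ (-x.valuation)‖ = 1 := by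
    rw [norm_mul, Padic.norm_eq_zpow_neg_valuation hx, Padic.norm_p_zpow, ← zpow_add₀ (by exact_mod_cast (Fact.out : p.Prime).ne_zero)]
    simp
  have hu := map_padicInt_eq_zero_of_isUnit he hvp (PadicInt.mkUnits hnorm).isUnit
  have hz (k : ℤ) : v ((p : F) ^ k) = ((e * k : ℤ) : WithTop ℤ) := by
    cases k with
    | ofNat k => simpa [mul_comm] using AddValuation.map_pow_eq_coe hvp k
    | negSucc k =>
      rw [zpow_negSucc, AddValuation.map_inv_eq_coe (AddValuation.map_pow_eq_coe hvp _),
        WithTop.coe_inj, Int.negSucc_eq]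
      push_cast
      ring
  have hx' : x = (PadicInt.mkUnits hnorm : ℤ_[p]) * (p : ℚ_[p]) ^ x.valuation := by
    rw [PadicInt.mkUnits_eq, mul_assoc, ← zpow_add₀ hp0]
    simp
  nth_rw 1 [hx']
  rw [map_mul, v.map_mul, hu, zero_add, map_zpow₀, map_natCast, hz]


lemma exists_spectralNorm_le_zpow_iff [FiniteDimensional ℚ_[p] F] (he : 0 < e)
    (hvp : v (p : F) = e) :
    ∃ ρ : ℝ, 0 < ρ ∧ ρ < 1 ∧
      ∀ (x : F) (k : ℤ), spectralNorm ℚ_[p] F x ≤ ρ ^ k ↔ (k : WithTop ℤ) ≤ v x := by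
  have hp1 : 1 < (p : ℝ) := by exact_mod_cast (Fact.out : p.Prime).one_lt
  have hp0 : 0 < (p : ℝ) := by linarith
  set ρ : ℝ := (p : ℝ) ^ (-(1 / e) : ℝ) with hρ
  have he' : (0 : ℝ) < e := by exact_mod_cast he
  have hρ0 : 0 < ρ := Real.rpow_pos_of_pos hp0 _
  have hρ1 : ρ < 1 := Real.rpow_lt_one_of_one_lt_of_neg hp1 (by simpa using he')
  have hρe (k : ℤ) : ρ ^ (e * k) = (p : ℝ) ^ (-k) := by
    rw [hρ, ← Real.rpow_intCast, ← Real.rpow_intCast, ← Real.rpow_mul hp0.le]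
    congr 1
    push_cast
    field_simp
  have htop {x : F} (hx : x ≠ 0) : (((v x).untopD 0 : ℤ) : WithTop ℤ) = v x := by
    obtain ⟨k, hk⟩ := AddValuation.exists_eq_coe (v := v) hx
    rw [hk]
    rfl
  classical
  let N (x : F) : ℝ := if x = 0 then 0 else ρ ^ ((v x).untopD 0)
  have hN (x : F) (k : ℤ) : N x ≤ ρ ^ k ↔ (k : WithTop ℤ) ≤ v x := by
    by_cases hx : x = 0
    · simp [N, hx, (zpow_pos hρ0 k).le]
    · simp only [N, hx, if_false]
      rw [zpow_le_zpow_iff_right_of_lt_one₀ hρ0 hρ1, ← WithTop.coe_le_coe, htop hx]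
  have hNv {x : F} (hx : x ≠ 0) {k : ℤ} (h : v x = k) : N x = ρ ^ k := by
    simp only [N, hx, if_false, h]
    rfl
  let f : AbsoluteValue F ℝ :=
    { toFun := N
      map_mul' := fun x y => by
        by_cases hx : x = 0
        · simp [N, hx]
        by_cases hy : y = 0
        · simp [N, hy]
        obtain ⟨k, hk⟩ := AddValuation.exists_eq_coe (v := v) hx
        obtain ⟨l, hl⟩ := AddValuation.exists_eq_coe (v := v) hy
        rw [hNv hx hk, hNv hy hl, hNv (mul_ne_zero hx hy) (AddValuation.map_mul_eq_coe hk hl),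
          zpow_add₀ hρ0.ne']
      nonneg' := fun x => by
        by_cases hx : x = 0
        · simp [N, hx]
        · simp [N, hx, (zpow_pos hρ0 _).le]
      eq_zero' := fun x => by
        by_cases hx : x = 0
        · simp [N, hx]
        · simp [N, hx, (zpow_pos hρ0 _).ne']
      add_le' := fun x y => by
        have hnn (x : F) : 0 ≤ N x := by
          by_cases hx : x = 0
          · simp [N, hx]
          · simp [N, hx, (zpow_pos hρ0 _).le]
        by_cases hx : x = 0
        · simp [N, hx]
        by_cases hy : y = 0
        · simp [N, hy]
        obtain ⟨k, hk⟩ := AddValuation.exists_eq_coe (v := v) hx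
        obtain ⟨l, hl⟩ := AddValuation.exists_eq_coe (v := v) hy
        have h1 : N (x + y) ≤ ρ ^ (min k l) := by
          rw [hN, WithTop.coe_min, ← hk, ← hl]
          exact v.map_add x y
        rcases min_choice k l with h | h
        · rw [h, ← hNv hx hk] at h1
          linarith [hnn y]
        · rw [h, ← hNv hy hl] at h1
          linarith [hnn x] }
  refine ⟨ρ, hρ0, hρ1, fun x k => ?_⟩
  rw [← spectralNorm_unique_field_norm_ext (f := f) (fun x => ?_)]
  · exact hN x k
  · by_cases hx : x = 0
    · simp [hx]
    · change N _ = _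
      rw [hNv ((_root_.map_ne_zero _).mpr hx) (map_padic_eq he hvp hx), hρe,
        Padic.norm_eq_zpow_neg_valuation hx]

lemma isIntegral_iff_nonneg [FiniteDimensional ℚ_[p] F] [Algebra ℤ_[p] F]
    [IsScalarTower ℤ_[p] ℚ_[p] F] (he : 0 < e) (hvp : v (p : F) = e) (x : F) :
    IsIntegral ℤ_[p] x ↔ 0 ≤ v x := by
  obtain ⟨ρ, -, -, hρ⟩ := exists_spectralNorm_le_zpow_iff (v := v) he hvp
  have h0 := hρ x 0
  rw [zpow_zero, WithTop.coe_zero] at h0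
  have hx : IsIntegral ℚ_[p] x := Algebra.IsIntegral.isIntegral x
  rw [← h0, spectralNorm, spectralValue_le_one_iff (minpoly.monic hx)]
  constructor
  · intro h n
    rw [minpoly.isIntegrallyClosed_eq_field_fractions' ℚ_[p] h, coeff_map]
    exact PadicInt.norm_le_one _
  · intro h
    have hl : minpoly ℚ_[p] x ∈ lifts (algebraMap ℤ_[p] ℚ_[p]) := by
      rw [lifts_iff_coeff_lifts]
      exact fun n => ⟨⟨_, h n⟩, rfl⟩
    obtain ⟨g, hg, -, hmon⟩ := lifts_and_natDegree_eq_and_monic hl (minpoly.monic hx)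
    refine ⟨g, hmon, ?_⟩
    rw [IsScalarTower.algebraMap_eq ℤ_[p] ℚ_[p] F, ← eval₂_map, hg]
    exact minpoly.aeval _ _

lemma exists_limit [FiniteDimensional ℚ_[p] F] (he : 0 < e) (hvp : v (p : F) = e) (s : ℕ → F)
    (hs : ∀ k : ℕ, ((k : ℤ) : WithTop ℤ) ≤ v (s (k + 1) - s k)) :
    ∃ l : F, ∀ k : ℕ, ((k : ℤ) : WithTop ℤ) ≤ v (l - s k) := by
  obtain ⟨ρ, hρ0, hρ1, hρ⟩ := exists_spectralNorm_le_zpow_iff (v := v) he hvp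
  let := spectralNorm.normedField ℚ_[p] F
  have : CompleteSpace F := spectralNorm.completeSpace ℚ_[p] F
  have hdist (x y : F) (k : ℕ) : dist x y ≤ ρ ^ k ↔ ((k : ℤ) : WithTop ℤ) ≤ v (x - y) := by
    rw [← hρ, zpow_natCast]
    rfl
  have hc : CauchySeq s := by
    refine cauchySeq_of_le_geometric ρ 1 hρ1 fun n => ?_
    rw [dist_comm, one_mul, hdist]
    exact hs n
  obtain ⟨l, hl⟩ := cauchySeq_tendsto_of_complete hc
  refine ⟨l, fun k => ?_⟩
  rw [← hdist]
  refine le_of_tendsto (hl.dist tendsto_const_nhds) ?_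
  filter_upwards [Filter.eventually_ge_atTop k] with j hj
  rw [hdist]
  induction j, hj using Nat.le_induction with
  | base => simp
  | succ j hj ih =>
    rw [← sub_add_sub_cancel]
    refine v.map_le_add (le_trans ?_ (hs j)) ih
    exact_mod_cast hj


lemma exists_pow_prime_eq [FiniteDimensional ℚ_[p] F] (he : 0 < e) (hvp : v (p : F) = e) {b : ℤ}
    (hb : 1 ≤ b) (hbe : e < (p - 1) * b) {u : F} (hu : ((b + e : ℤ) : WithTop ℤ) ≤ v (u - 1)) :
    ∃ w : F, w ^ p = u ∧ (b : WithTop ℤ) ≤ v (w - 1) := by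
  have hp : p.Prime := Fact.out
  have hp0 : (p : F) ≠ 0 := by
    have := algebraRat.charZero ℚ_[p]
    have : CharZero F := charZero_of_injective_algebraMap (algebraMap ℚ_[p] F).injective
    exact_mod_cast hp.ne_zero
  have hpinv := AddValuation.map_inv_eq_coe hvp
  let s (k : ℕ) : F := (fun w => w + (u - w ^ p) * (p : F)⁻¹)^[k] 1
  have hs (k : ℕ) : s (k + 1) = s k + (u - s k ^ p) * (p : F)⁻¹ :=
    Function.iterate_succ_apply' _ _ _
  have hinv (k : ℕ) : (b : WithTop ℤ) ≤ v (s k - 1) ∧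
      ((b + k + e : ℤ) : WithTop ℤ) ≤ v (u - s k ^ p) := by
    induction k with
    | zero => simpa [s] using hu
    | succ k ih =>
      obtain ⟨ih1, ih2⟩ := ih
      have hε : ((b + k : ℤ) : WithTop ℤ) ≤ v ((u - s k ^ p) * (p : F)⁻¹) := by
        convert AddValuation.le_map_mul ih2 hpinv.ge using 2
        ring
      have hpε : p * ((u - s k ^ p) * (p : F)⁻¹) = u - s k ^ p := by field_simp
      have hk : (0 : ℤ) ≤ k := by positivity
      have hp1 : (1 : ℤ) < p := by exact_mod_cast hp.one_lt
      have hstep := le_map_mul_sub_add_pow_sub_pow hvp (w := s k) (by linarith) (by nlinarith)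
        (le_trans (by exact_mod_cast hb) ih1) hε
      rw [hpε, ← hs] at hstep
      constructor
      · rw [hs, add_sub_right_comm]
        refine v.map_le_add ih1 (le_trans ?_ hε)
        rw [WithTop.coe_le_coe]
        linarith
      · convert hstep using 2
        · push_cast; ring
        · ring
  obtain ⟨l, hl⟩ := exists_limit he hvp s fun k => by
    rw [hs, add_sub_cancel_left]
    have := AddValuation.le_map_mul (hinv k).2 hpinv.ge
    refine le_trans ?_ this
    rw [WithTop.coe_le_coe]
    linarith
  have hlb : (b : WithTop ℤ) ≤ v (l - 1) := by
    rw [← sub_add_sub_cancel l (s b.toNat) 1]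
    refine v.map_le_add (le_trans ?_ (hl _)) (hinv _).1
    rw [WithTop.coe_le_coe]
    omega
  refine ⟨l, ?_, hlb⟩
  rw [eq_comm, ← sub_eq_zero]
  refine AddValuation.eq_zero_of_forall_natCast_le (v := v) fun k => ?_
  rw [← sub_sub_sub_cancel_right u (l ^ p) (s k ^ p)]
  refine v.map_le_sub (le_trans ?_ (hinv k).2) ((hl k).trans ?_)
  · rw [WithTop.coe_le_coe]
    linarith
  · exact AddValuation.le_map_pow_sub_pow
      (AddValuation.nonneg_of_le_map_sub_one (by linarith) hlb)
      (AddValuation.nonneg_of_le_map_sub_one (by linarith) (hinv k).1) p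

lemma exists_pow_prime_pow_eq [FiniteDimensional ℚ_[p] F] (he : 0 < e) (hvp : v (p : F) = e)
    {b : ℤ} (hb : 1 ≤ b) (hbe : e < (p - 1) * b) (k : ℕ) {u : F}
    (hu : ((b + k * e : ℤ) : WithTop ℤ) ≤ v (u - 1)) :
    ∃ w : F, w ^ p ^ k = u ∧ (b : WithTop ℤ) ≤ v (w - 1) := by
  have hp1 : (1 : ℤ) < p := by exact_mod_cast (Fact.out : p.Prime).one_lt
  induction k generalizing u with
  | zero => exact ⟨u, by simp, by simpa using hu⟩
  | succ k ih =>
    have hke : 0 ≤ k * e := by positivity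
    obtain ⟨w, rfl, hw⟩ := exists_pow_prime_eq he hvp (b := b + k * e) (by linarith)
      (by nlinarith) (u := u) (by convert hu using 2; push_cast; ring)
    obtain ⟨z, rfl, hz⟩ := ih hw
    exact ⟨z, by rw [pow_succ, pow_mul], hz⟩

end AddValuation

section KummerNorm

lemma Algebra.norm_algebraMap_sub_gen {F K : Type*} [Field F] [Field K] [Algebra F K]
    (pb : PowerBasis F K) (w : F) :
    Algebra.norm F (algebraMap F K w - pb.gen) = (minpoly F pb.gen).eval w := by
  rw [← charpoly_leftMulMatrix, Algebra.norm_eq_matrix_det pb.basis, Matrix.eval_charpoly, map_sub,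
    AlgHom.commutes, Matrix.algebraMap_eq_diagonal]
  rfl

lemma IsPrimitiveRoot.of_pow_prime_pow {M : Type*} [CommMonoid M] {p n k : ℕ} [Fact p.Prime]
    (hn : 1 ≤ n) {y : M} (hy : IsPrimitiveRoot (y ^ p ^ k) (p ^ n)) :
    IsPrimitiveRoot y (p ^ (n + k)) := by
  obtain ⟨n, rfl⟩ := Nat.exists_eq_add_of_le' hn
  have h1 : y ^ p ^ (n + k + 1) = 1 := by
    rw [show n + k + 1 = k + (n + 1) by ring, pow_add, pow_mul, hy.pow_eq_one]
  have h2 : ¬ y ^ p ^ (n + k) = 1 := by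
    rw [add_comm, pow_add, pow_mul, hy.pow_eq_one_iff_dvd]
    exact fun h => (Nat.pow_lt_pow_right (Fact.out : p.Prime).one_lt n.lt_succ_self).not_ge
      (Nat.le_of_dvd (pow_pos (Fact.out : p.Prime).pos _) h)
  rw [show n + 1 + k = n + k + 1 by ring, ← orderOf_eq_prime_pow h2 h1]
  exact IsPrimitiveRoot.orderOf y

variable {F : Type*} [Field F] {v : AddValuation F (WithTop ℤ)}

lemma AddValuation.map_multiset_prod_eq_coe {ι : Type*} {s : Multiset ι} {f : ι → F} {t : ℤ}
    (h : ∀ i ∈ s, v (f i) = t) : v (s.map f).prod = ((Multiset.card s * t : ℤ) : WithTop ℤ) := by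
  induction s using Multiset.induction_on with
  | empty => simp
  | cons a s ih =>
    rw [Multiset.map_cons, Multiset.prod_cons, Multiset.card_cons,
      AddValuation.map_mul_eq_coe (h a (Multiset.mem_cons_self a s))
        (ih fun i hi => h i (Multiset.mem_cons_of_mem hi))]
    congr 1
    push_cast
    ring

lemma AddValuation.map_one_sub_eq_of_isPrimitiveRoot {N : ℕ} [NeZero N] {ξ ζ : F}
    (hξ : IsPrimitiveRoot ξ N) (hζ : IsPrimitiveRoot ζ N) : v (1 - ξ) = v (1 - ζ) := by
  have h0 {x : F} (hx : IsPrimitiveRoot x N) : 0 ≤ v x := by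
    by_contra! h
    have h1 : N • v x = 0 := by rw [← v.map_pow, hx.pow_eq_one, v.map_one]
    exact (nsmul_neg h (NeZero.ne N)).ne h1
  have key {x y : F} (hx : IsPrimitiveRoot x N) (hy : IsPrimitiveRoot y N) :
      v (1 - x) ≤ v (1 - y) := by
    obtain ⟨i, -, rfl⟩ := hx.eq_pow_of_pow_eq_one hy.pow_eq_one
    simpa using AddValuation.le_map_pow_sub_pow v.map_one.ge (h0 hx) i
  exact le_antisymm (key hξ hζ) (key hζ hξ)

variable {p n : ℕ} [Fact p.Prime]

lemma pow_prime_ne_of_isPrimitiveRoot (hn : 1 ≤ n) {ζ : F} (hζ : IsPrimitiveRoot ζ (p ^ n))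
    (hv1 : v (1 - ζ) = (1 : WithTop ℤ)) (ω : F) : ω ^ p ≠ ζ := by
  rintro rfl
  have hp : p.Prime := Fact.out
  have hω : IsPrimitiveRoot ω (p ^ (n + 1)) := by
    apply IsPrimitiveRoot.of_pow_prime_pow (k := 1) hn
    rwa [pow_one]
  have : NeZero (p ^ (n + 1)) := ⟨pow_ne_zero _ hp.ne_zero⟩
  have hμ : IsPrimitiveRoot (ω ^ p ^ n) p := hω.pow (pow_pos hp.pos _) (pow_succ _ _)
  have hprod := hμ.pow_sub_pow_eq_prod_sub_mul (x := 1) (y := ω) hp.pos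
  have hω1 : 1 - ω ≠ 0 := by
    intro h
    rw [sub_eq_zero] at h
    rw [← h, one_pow, sub_self, v.map_zero] at hv1
    exact absurd hv1 (by simp)
  obtain ⟨t, ht⟩ := AddValuation.exists_eq_coe (v := v) hω1
  have hpr : v (∏ ξ ∈ nthRootsFinset p (1 : F), (1 - ξ * ω)) = ((p * t : ℤ) : WithTop ℤ) := by
    have h1 (a : F) (ha : a ∈ (nthRootsFinset p (1 : F)).val) : v (1 - a * ω) = t := by
      rw [Finset.mem_val, mem_nthRootsFinset hp.pos] at ha
      rw [← ht]
      apply AddValuation.map_one_sub_eq_of_isPrimitiveRoot (N := p ^ (n + 1)) _ hω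
      apply IsPrimitiveRoot.of_pow_prime_pow (k := 1) hn
      rwa [pow_one, mul_pow, ha, one_mul]
    rw [← Finset.prod_map_val, AddValuation.map_multiset_prod_eq_coe h1, Finset.card_val,
      hμ.card_nthRootsFinset]
  rw [← hprod, one_pow, hv1, ← WithTop.coe_one, WithTop.coe_inj] at hpr
  have h1 : (p : ℤ) ∣ 1 := ⟨t, hpr⟩
  have h2 : p ∣ 1 := by exact_mod_cast h1
  exact hp.one_lt.ne' (Nat.dvd_one.mp h2)

lemma minpoly_eq_X_pow_sub_C {K : Type*} [Field K] [Algebra F K] (hp2 : p ≠ 2) (hn : 1 ≤ n) {ζ : F}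
    (hζ : IsPrimitiveRoot ζ (p ^ n)) (hv1 : v (1 - ζ) = (1 : WithTop ℤ)) {k : ℕ} {y : K}
    (hy : y ^ p ^ k = algebraMap F K ζ) : minpoly F y = X ^ p ^ k - C ζ := by
  have hp : p.Prime := Fact.out
  refine (minpoly.eq_of_irreducible_of_monic ?_ ?_ ?_).symm
  · exact X_pow_sub_C_irreducible_of_prime_pow hp hp2 k
      (pow_prime_ne_of_isPrimitiveRoot hn hζ hv1)
  · simp [hy]
  · exact monic_X_pow_sub_C _ (pow_ne_zero _ hp.ne_zero)

lemma exists_isPrimitiveRoot_pow_eq {K : Type*} [Field K] [Algebra F K] (hn : 1 ≤ n) {ζ : F}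
    (hζ : IsPrimitiveRoot ζ (p ^ n)) {δ : ℤ} (hδ : δ ≠ 0) (hδ' : padicValInt p δ ≤ n - 1) {y : K}
    (hy : y ^ p ^ n = algebraMap F K (ζ ^ δ)) :
    ∃ ξ : F, IsPrimitiveRoot ξ (p ^ n) ∧ y ^ p ^ (n - padicValInt p δ) = algebraMap F K ξ := by
  have hp : p.Prime := Fact.out
  have : NeZero (p ^ n) := ⟨pow_ne_zero _ hp.ne_zero⟩
  have hζK := hζ.map_of_injective (algebraMap F K).injective
  rw [map_zpow₀] at hy
  set d := padicValInt p δ with hd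
  obtain ⟨n, rfl⟩ := Nat.exists_eq_add_of_le' hn
  obtain ⟨k, hk⟩ : ∃ k, n = d + k := Nat.exists_eq_add_of_le (by omega)
  have hkd : n + 1 - d = k + 1 := by omega
  rw [hkd]
  have hpow (i : ℕ) : (y ^ p ^ (k + 1)) ^ p ^ (d + i) = 1 ↔
      (p : ℤ) ^ (d + k + 1) ∣ δ * (p : ℤ) ^ i := by
    rw [← pow_mul, ← pow_add, show k + 1 + (d + i) = n + 1 + i by omega, pow_add, pow_mul, hy,
      ← zpow_natCast, ← zpow_mul, hζK.zpow_eq_one_iff_dvd, hk]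
    push_cast
    rfl
  have hp0 : (p : ℤ) ≠ 0 := by exact_mod_cast hp.ne_zero
  have h1 : ¬ (y ^ p ^ (k + 1)) ^ p ^ n = 1 := by
    rw [hk, hpow, show d + k + 1 = d + 1 + k by ring, pow_add,
      mul_dvd_mul_iff_right (pow_ne_zero _ hp0), padicValInt_dvd_iff]
    omega
  have h2 : (y ^ p ^ (k + 1)) ^ p ^ (n + 1) = 1 := by
    rw [hk, add_assoc, hpow, add_assoc, pow_add]
    refine mul_dvd_mul_right ?_ _
    rw [padicValInt_dvd_iff]
    omega
  have h3 : IsPrimitiveRoot (y ^ p ^ (k + 1)) (p ^ (n + 1)) := by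
    rw [← orderOf_eq_prime_pow h1 h2]
    exact IsPrimitiveRoot.orderOf _
  obtain ⟨i, -, hi⟩ := hζK.eq_pow_of_pow_eq_one h2
  refine ⟨ζ ^ i, ?_, by rw [← hi, map_pow]⟩
  rw [← hi, ← map_pow] at h3
  exact h3.of_map_of_injective (algebraMap F K).injective

/-- If `y ^ p ^ k` is a primitive `p ^ n`-th root of unity `ζ` of `F`, every element close enough
to `1` is a norm from `F(y)`: up to a `p ^ k`-th root it has the form
`(w ^ p ^ k - ζ) / (1 - ζ)`. -/
lemma exists_norm_eq_of_le_map_sub_one [Algebra ℚ_[p] F] [FiniteDimensional ℚ_[p] F] {K : Type*}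
    [Field K] [Algebra F K] (hp2 : p ≠ 2) (hn : 1 ≤ n) {ζ : F} (hζ : IsPrimitiveRoot ζ (p ^ n))
    (hv1 : v (1 - ζ) = (1 : WithTop ℤ))
    (hvp : v (p : F) = (((p : ℤ) ^ (n - 1) * ((p : ℤ) - 1) : ℤ) : WithTop ℤ)) {k : ℕ} {y : K}
    (hy : y ^ p ^ k = algebraMap F K ζ) {u : F}
    (hu : (((p : ℤ) ^ (n - 1) * (k * ((p : ℤ) - 1) + 1) : ℤ) : WithTop ℤ) ≤ v (u - 1)) :
    ∃ z : IntermediateField.adjoin F {y}, Algebra.norm F z = u := by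
  have hp : p.Prime := Fact.out
  have hp1 : (1 : ℤ) < p := by exact_mod_cast hp.one_lt
  have hP : (0 : ℤ) < (p : ℤ) ^ (n - 1) := by positivity
  have he : 0 < (p : ℤ) ^ (n - 1) * ((p : ℤ) - 1) := mul_pos hP (by omega)
  have hζ1 : 1 - ζ ≠ 0 := by
    intro h
    rw [h, v.map_zero] at hv1
    exact absurd hv1 (by simp)
  have hmul : ((((p : ℤ) ^ (n - 1) + 1) + k * ((p : ℤ) ^ (n - 1) * ((p : ℤ) - 1)) : ℤ) :
      WithTop ℤ) ≤ v ((1 + (1 - ζ) * (u - 1)) - 1) := by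
    rw [add_sub_cancel_left]
    convert AddValuation.le_map_mul (k := 1) (x := 1 - ζ) hv1.ge hu using 2
    ring
  obtain ⟨w, hw, -⟩ := exists_pow_prime_pow_eq he hvp (by omega) (by nlinarith) k hmul
  have hmin := minpoly_eq_X_pow_sub_C hp2 hn hζ hv1 hy
  have hintegral : IsIntegral F y := by
    by_contra h
    rw [minpoly.eq_zero h] at hmin
    exact (monic_X_pow_sub_C ζ (pow_ne_zero k hp.ne_zero)).ne_zero hmin.symm
  have hnorm (x : F) : Algebra.norm F (algebraMap F (IntermediateField.adjoin F {y}) x -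
      IntermediateField.AdjoinSimple.gen F y) = x ^ p ^ k - ζ := by
    have := Algebra.norm_algebraMap_sub_gen (IntermediateField.adjoin.powerBasis hintegral) x
    rw [IntermediateField.adjoin.powerBasis_gen, IntermediateField.minpoly_gen, hmin] at this
    simpa using this
  have hB := hnorm 1
  rw [one_pow] at hB
  have hB0 : algebraMap F _ 1 - IntermediateField.AdjoinSimple.gen F y ≠ 0 := by
    intro h
    rw [h] at hB
    have := IntermediateField.adjoin.finiteDimensional hintegral
    exact hζ1 (by rw [← hB, Algebra.norm_zero])
  refine ⟨(algebraMap F _ w - IntermediateField.AdjoinSimple.gen F y) /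
    (algebraMap F _ 1 - IntermediateField.AdjoinSimple.gen F y), ?_⟩
  apply mul_right_cancel₀ hζ1
  rw [← hB, ← map_mul, div_mul_cancel₀ _ hB0, hB, hnorm, hw]
  ring

end KummerNorm

section TraceUnit

variable {p : ℕ} [Fact p.Prime] {E : Type*} [Field E] {v : AddValuation E (WithTop ℤ)} {e : ℤ}
  [Algebra ℚ_[p] E] [FiniteDimensional ℚ_[p] E]

/-- An unramified extension of `ℚ_[p]` contains an integer whose trace is a unit. -/
lemma exists_isUnit_trace_eq (he : 0 < e) (hvp : v (p : E) = e)
    (hunram : ∀ x : E, x ≠ 0 → ∃ k : ℤ, v x = ((e * k : ℤ) : WithTop ℤ)) :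
    ∃ c : E, 0 ≤ v c ∧ ∃ t : ℤ_[p], IsUnit t ∧ Algebra.trace ℚ_[p] E c = t := by
  have hp : p.Prime := Fact.out
  let : Algebra ℤ_[p] E := ((algebraMap ℚ_[p] E).comp (algebraMap ℤ_[p] ℚ_[p])).toAlgebra
  have : IsScalarTower ℤ_[p] ℚ_[p] E := IsScalarTower.of_algebraMap_eq fun _ => rfl
  let B := integralClosure ℤ_[p] E
  have hB (x : E) : x ∈ B ↔ 0 ≤ v x := isIntegral_iff_nonneg he hvp x
  have : Module.Finite ℤ_[p] B := IsIntegralClosure.finite ℤ_[p] ℚ_[p] E B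
  have : Module.Free ℤ_[p] B := by
    have : Module.IsTorsionFree ℤ_[p] E := Module.IsTorsionFree.trans_faithfulSMul ℤ_[p] ℚ_[p] E
    exact IsIntegralClosure.module_free ℤ_[p] ℚ_[p] E B
  have : IsLocalization (Algebra.algebraMapSubmonoid B (nonZeroDivisors ℤ_[p])) E :=
    IsIntegralClosure.isLocalization ℤ_[p] ℚ_[p] E B
  have hmap : (IsLocalRing.maximalIdeal ℤ_[p]).map (algebraMap ℤ_[p] B) =
      Ideal.span {(p : B)} := by
    rw [PadicInt.maximalIdeal_eq_span_p, Ideal.map_span, Set.image_singleton, map_natCast]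
  have hmax : ((IsLocalRing.maximalIdeal ℤ_[p]).map (algebraMap ℤ_[p] B)).IsMaximal := by
    rw [hmap, Ideal.isMaximal_iff]
    refine ⟨fun h => ?_, fun J x _ hx hxJ => ?_⟩
    · rw [Ideal.mem_span_singleton] at h
      obtain ⟨c, hc⟩ := h
      have h1 : (1 : E) = p * (c : E) := by exact_mod_cast congrArg Subtype.val hc
      have h2 := AddValuation.le_map_mul_of_nonneg_right hvp.ge ((hB c).1 c.2)
      rw [← h1, v.map_one, ← WithTop.coe_zero, WithTop.coe_le_coe] at h2
      omega
    · have hx0 : (x : E) ≠ 0 := by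
        intro h
        apply hx
        rw [show x = 0 from Subtype.ext h]
        exact zero_mem _
      obtain ⟨k, hk⟩ := hunram x hx0
      have hk0 : 0 ≤ e * k := by
        have := (hB x).1 x.2
        rwa [hk, ← WithTop.coe_zero, WithTop.coe_le_coe] at this
      have hk1 : 0 ≤ k := nonneg_of_mul_nonneg_right hk0 he
      have hinv : 0 ≤ v ((x : E)⁻¹) := by
        by_contra hneg
        apply hx
        have hk2 : k ≠ 0 := by
          rintro rfl
          exact hneg (by rw [AddValuation.map_inv_eq_coe hk]; simp)
        have hdiv : (p : E)⁻¹ * x ∈ B := by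
          rw [hB, AddValuation.map_mul_eq_coe (AddValuation.map_inv_eq_coe hvp) hk,
            ← WithTop.coe_zero, WithTop.coe_le_coe]
          have : 1 ≤ k := by omega
          nlinarith
        rw [Ideal.mem_span_singleton]
        refine ⟨⟨_, hdiv⟩, Subtype.ext ?_⟩
        have hp0 : (p : E) ≠ 0 := by
          intro h
          rw [h, v.map_zero] at hvp
          exact absurd hvp (by simp)
        simp [hp0]
      have : (⟨_, (hB _).2 hinv⟩ : B) * x = 1 := Subtype.ext (inv_mul_cancel₀ hx0)
      rw [← this]
      exact J.mul_mem_left _ hxJ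
  let := Ideal.Quotient.field (IsLocalRing.maximalIdeal ℤ_[p])
  let := Ideal.Quotient.field ((IsLocalRing.maximalIdeal ℤ_[p]).map (algebraMap ℤ_[p] B))
  have : Finite (ℤ_[p] ⧸ IsLocalRing.maximalIdeal ℤ_[p]) :=
    Finite.of_equiv _ (PadicInt.residueField (p := p)).symm.toEquiv
  have : Module.Finite (ℤ_[p] ⧸ IsLocalRing.maximalIdeal ℤ_[p])
      (B ⧸ (IsLocalRing.maximalIdeal ℤ_[p]).map (algebraMap ℤ_[p] B)) := inferInstance
  have hne := Algebra.trace_ne_zero (ℤ_[p] ⧸ IsLocalRing.maximalIdeal ℤ_[p])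
    (B ⧸ (IsLocalRing.maximalIdeal ℤ_[p]).map (algebraMap ℤ_[p] B))
  obtain ⟨x, hx⟩ := DFunLike.ne_iff.mp hne
  obtain ⟨c, rfl⟩ := Ideal.Quotient.mk_surjective x
  refine ⟨c, (hB c).1 c.2, Algebra.trace ℤ_[p] B c, ?_, ?_⟩
  · by_contra h
    apply hx
    rw [Algebra.trace_quotient_mk, LinearMap.zero_apply, Ideal.Quotient.eq_zero_iff_mem]
    exact h
  · exact Algebra.trace_localization ℤ_[p] (nonZeroDivisors ℤ_[p]) (Rₘ := ℚ_[p]) (Sₘ := E) c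

end TraceUnit

section CyclotomicTrace

lemma sum_nthRootsFinset_pow {K : Type*} [CommRing K] [IsDomain K] {N : ℕ} (hN : 0 < N) {ζ : K}
    (hζ : IsPrimitiveRoot ζ N) {i : ℕ} (hi0 : i ≠ 0) (hi : i < N) :
    ∑ ξ ∈ nthRootsFinset N (1 : K), ξ ^ i = 0 := by
  have h1 : ζ ^ i * ∑ ξ ∈ nthRootsFinset N (1 : K), ξ ^ i =
      ∑ ξ ∈ nthRootsFinset N (1 : K), ξ ^ i := by
    rw [Finset.mul_sum]
    have hζ0 : ζ ^ N = 1 := hζ.pow_eq_one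
    have hinv : ζ ^ (N - 1) * ζ = 1 := by rw [← pow_succ, Nat.sub_add_cancel hN, hζ0]
    refine Finset.sum_nbij' (fun ξ => ζ * ξ) (fun ξ => ζ ^ (N - 1) * ξ) ?_ ?_ ?_ ?_ ?_
    · intro ξ h
      rw [mem_nthRootsFinset hN] at h ⊢
      rw [mul_pow, hζ0, h, one_mul]
    · intro ξ h
      rw [mem_nthRootsFinset hN] at h ⊢
      rw [mul_pow, ← pow_mul, mul_comm, mul_comm (N - 1), pow_mul, hζ0, h, one_pow, one_mul]
    · intro ξ _
      rw [← mul_assoc, hinv, one_mul]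
    · intro ξ _
      rw [← mul_assoc, mul_comm ζ, hinv, one_mul]
    · intro ξ _
      rw [mul_pow]
  have h2 : (ζ ^ i - 1) * ∑ ξ ∈ nthRootsFinset N (1 : K), ξ ^ i = 0 := by
    rw [sub_mul, h1, one_mul, sub_self]
  exact (mul_eq_zero.mp h2).resolve_left
    (sub_ne_zero.mpr (hζ.pow_ne_one_of_pos_of_lt hi0 hi))

lemma sum_nthRootsFinset_sum_range {K : Type*} [CommRing K] [IsDomain K] {M N : ℕ} (hM : 0 < M)
    (hMN : M ≤ N) {ζ : K} (hζ : IsPrimitiveRoot ζ N) :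
    ∑ ξ ∈ nthRootsFinset N (1 : K), ∑ i ∈ Finset.range M, ξ ^ i = N := by
  rw [Finset.sum_comm, Finset.sum_eq_single_of_mem 0 (Finset.mem_range.mpr hM)]
  · simp [hζ.card_nthRootsFinset]
  · intro i hi hi0
    exact sum_nthRootsFinset_pow (by omega) hζ hi0 ((Finset.mem_range.mp hi).trans_le hMN)

variable {p m : ℕ} [Fact p.Prime] {E F : Type*} [Field E] [Field F] [Algebra E F]
  {v : AddValuation F (WithTop ℤ)} {ζ : F}

lemma sum_primitiveRoots_sum_range {K : Type*} [CommRing K] [IsDomain K] {ζ : K}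
    (hζ : IsPrimitiveRoot ζ (p ^ (m + 1))) :
    ∑ ξ ∈ primitiveRoots (p ^ (m + 1)) K, ∑ i ∈ Finset.range (p ^ m), ξ ^ i =
      (p : K) ^ m * (p - 1) := by
  classical
  have hp : p.Prime := Fact.out
  have h1 := sum_nthRootsFinset_sum_range (pow_pos hp.pos m)
    (Nat.pow_le_pow_right hp.pos m.le_succ) hζ
  have h2 := sum_nthRootsFinset_sum_range (pow_pos hp.pos m) le_rfl
    (hζ.pow (pow_pos hp.pos _) (pow_succ' p m))
  rw [nthRootsFinset_prime_pow_succ, Finset.sum_disjUnion, h2, ← eq_sub_iff_add_eq] at h1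
  rw [h1, pow_succ]
  push_cast
  ring

lemma trace_sum_range_eq [CharZero E] (hζ : IsPrimitiveRoot ζ (p ^ (m + 1)))
    [IsCyclotomicExtension {p ^ (m + 1)} E F] (hirr : Irreducible (cyclotomic (p ^ (m + 1)) E)) :
    Algebra.trace E F (∑ i ∈ Finset.range (p ^ m), ζ ^ i) = (p : E) ^ m * (p - 1) := by
  have hp : p.Prime := Fact.out
  have : NeZero (p ^ (m + 1)) := ⟨pow_ne_zero _ hp.ne_zero⟩
  have := IsCyclotomicExtension.finiteDimensional {p ^ (m + 1)} E F
  apply (algebraMap E (AlgebraicClosure F)).injective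
  rw [trace_eq_sum_embeddings]
  have hζ' := hζ.map_of_injective (algebraMap F (AlgebraicClosure F)).injective
  rw [map_mul, map_pow, map_sub, map_one, map_natCast, ← sum_primitiveRoots_sum_range hζ',
    ← Finset.sum_coe_sort (primitiveRoots _ _)]
  refine Fintype.sum_equiv (hζ.embeddingsEquivPrimitiveRoots (AlgebraicClosure F) hirr) _ _
    fun σ => ?_
  rw [hζ.embeddingsEquivPrimitiveRoots_apply_coe, map_sum]
  simp_rw [map_pow]

lemma irreducible_cyclotomic_of_unramified (hζ : IsPrimitiveRoot ζ (p ^ (m + 1)))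
    [CharZero E] (hv1 : v (1 - ζ) = (1 : WithTop ℤ))
    (hunram : ∀ x : E, x ≠ 0 → ∃ k : ℤ,
      v (algebraMap E F x) = (((p : ℤ) ^ m * ((p : ℤ) - 1) * k : ℤ) : WithTop ℤ)) :
    Irreducible (cyclotomic (p ^ (m + 1)) E) := by
  have hp : p.Prime := Fact.out
  have hpos : 0 < p ^ (m + 1) := pow_pos hp.pos _
  have : NeZero (p ^ (m + 1)) := ⟨hpos.ne'⟩
  have hcyc : aeval ζ (cyclotomic (p ^ (m + 1)) E) = 0 := by
    rw [aeval_def, eval₂_eq_eval_map, map_cyclotomic]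
    exact hζ.isRoot_cyclotomic hpos
  have hintegral : IsIntegral E ζ := ⟨_, cyclotomic.monic _ _, hcyc⟩
  have hdvd : minpoly E ζ ∣ cyclotomic (p ^ (m + 1)) E := minpoly.dvd E ζ hcyc
  have hdvd' : (minpoly E ζ).map (algebraMap E F) ∣ cyclotomic (p ^ (m + 1)) F := by
    rw [← map_cyclotomic (p ^ (m + 1)) (algebraMap E F)]
    exact Polynomial.map_dvd _ hdvd
  have hmon := (minpoly.monic hintegral).map (algebraMap E F)
  have hsplit : ((minpoly E ζ).map (algebraMap E F)).Splits := by
    refine Splits.of_dvd ?_ (cyclotomic_ne_zero _ F) hdvd'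
    exact (X_pow_sub_one_splits hζ).of_dvd (X_pow_sub_C_ne_zero hpos 1) (cyclotomic.dvd_X_pow_sub_one _ F)
  have hroots (ξ : F) (h : ξ ∈ ((minpoly E ζ).map (algebraMap E F)).roots) :
      v (1 - ξ) = (1 : ℤ) := by
    have : NeZero ((p ^ (m + 1) : ℕ) : F) := hζ.neZero'
    have h1 : IsPrimitiveRoot ξ (p ^ (m + 1)) := by
      rw [← isRoot_cyclotomic_iff]
      exact (isRoot_of_mem_roots h).dvd hdvd'
    rw [AddValuation.map_one_sub_eq_of_isPrimitiveRoot h1 hζ, hv1, WithTop.coe_one]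
  have hval := AddValuation.map_multiset_prod_eq_coe hroots
  rw [← hsplit.eval_eq_prod_roots_of_monic hmon, ← hsplit.natDegree_eq_card_roots, natDegree_map,
    mul_one] at hval
  have h1 : algebraMap E F ((minpoly E ζ).eval 1) = ((minpoly E ζ).map (algebraMap E F)).eval 1 := by
    rw [eval_one_map]
  have h2 : (minpoly E ζ).eval 1 ≠ 0 := by
    intro h
    rw [← h1, h, map_zero, v.map_zero] at hval
    exact absurd hval (by simp)
  obtain ⟨k, hk⟩ := hunram _ h2
  rw [h1, hval, WithTop.coe_inj] at hk
  have hdeg : (p ^ m * (p - 1) : ℕ) ≤ (minpoly E ζ).natDegree := by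
    apply Nat.le_of_dvd (minpoly.natDegree_pos hintegral)
    zify [hp.one_le]
    exact ⟨k, hk⟩
  rw [eq_of_monic_of_dvd_of_natDegree_le (minpoly.monic hintegral) (cyclotomic.monic _ E) hdvd ?_]
  · exact minpoly.irreducible hintegral
  · rwa [natDegree_cyclotomic, Nat.totient_prime_pow_succ hp]

lemma map_one_sub_pow_prime_pow_eq (hζ : IsPrimitiveRoot ζ (p ^ (m + 1)))
    (hvp : v (p : F) = (((p : ℤ) ^ m * ((p : ℤ) - 1) : ℤ) : WithTop ℤ)) :
    v (1 - ζ ^ p ^ m) = (((p : ℤ) ^ m : ℤ) : WithTop ℤ) := by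
  have hp : p.Prime := Fact.out
  have : NeZero p := ⟨hp.ne_zero⟩
  have hμ : IsPrimitiveRoot (ζ ^ p ^ m) p := hζ.pow (pow_pos hp.pos _) (pow_succ p m)
  have hne : 1 - ζ ^ p ^ m ≠ 0 := sub_ne_zero.mpr (hμ.ne_one hp.one_lt).symm
  obtain ⟨t, ht⟩ := AddValuation.exists_eq_coe (v := v) hne
  have hval := AddValuation.map_multiset_prod_eq_coe (v := v) (f := fun ξ => 1 - ξ)
    (s := (primitiveRoots p F).val) (t := t) fun ξ hξ => by
      rw [← ht]
      exact AddValuation.map_one_sub_eq_of_isPrimitiveRoot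
        ((mem_primitiveRoots hp.pos).1 hξ) hμ
  have heval : (cyclotomic p F).eval 1 = (p : F) := eval_one_cyclotomic_prime
  rw [cyclotomic_eq_prod_X_sub_primitiveRoots hμ, eval_prod] at heval
  simp only [eval_sub, eval_X, eval_C] at heval
  rw [Finset.prod_map_val, heval, hvp, Finset.card_val, hμ.card_primitiveRoots,
    Nat.totient_prime hp, WithTop.coe_inj, Nat.cast_sub hp.one_le, Nat.cast_one, mul_comm] at hval
  have hp1 : (p : ℤ) - 1 ≠ 0 := by
    have := hp.one_lt
    omega
  rw [ht, mul_left_cancel₀ hp1 hval]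

lemma exists_trace_eq_prime_pow_mul [Algebra ℚ_[p] E] [Algebra ℚ_[p] F] [IsScalarTower ℚ_[p] E F]
    [FiniteDimensional ℚ_[p] E] [IsCyclotomicExtension {p ^ (m + 1)} E F]
    (hζ : IsPrimitiveRoot ζ (p ^ (m + 1))) (hv1 : v (1 - ζ) = (1 : WithTop ℤ))
    (hvp : v (p : F) = (((p : ℤ) ^ m * ((p : ℤ) - 1) : ℤ) : WithTop ℤ))
    (hunram : ∀ x : E, x ≠ 0 → ∃ k : ℤ,
      v (algebraMap E F x) = (((p : ℤ) ^ m * ((p : ℤ) - 1) * k : ℤ) : WithTop ℤ)) :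
    ∃ a : F, (((p : ℤ) ^ m - 1 : ℤ) : WithTop ℤ) ≤ v a ∧
      ∃ t : ℤ_[p], IsUnit t ∧ Algebra.trace ℚ_[p] F a = (((p : ℤ_[p]) ^ m * t : ℤ_[p]) : ℚ_[p]) := by
  have hp : p.Prime := Fact.out
  have hp1 : (1 : ℤ) < p := by exact_mod_cast hp.one_lt
  have he : 0 < (p : ℤ) ^ m * ((p : ℤ) - 1) := mul_pos (by positivity) (by omega)
  have : NeZero (p ^ (m + 1)) := ⟨pow_ne_zero _ hp.ne_zero⟩
  have := IsCyclotomicExtension.finiteDimensional {p ^ (m + 1)} E F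
  have : CharZero E := charZero_of_injective_algebraMap (algebraMap ℚ_[p] E).injective
  obtain ⟨c, hc, t, ht, hct⟩ := exists_isUnit_trace_eq (v := v.comap (algebraMap E F)) he
    (by rwa [← map_natCast (algebraMap E F)] at hvp) hunram
  have htr := trace_sum_range_eq hζ (irreducible_cyclotomic_of_unramified hζ hv1 hunram)
  refine ⟨algebraMap E F c * ∑ i ∈ Finset.range (p ^ m), ζ ^ i, ?_, (p - 1 : ℕ) * t, ?_, ?_⟩
  · rw [mul_comm]
    refine AddValuation.le_map_mul_of_nonneg_right ?_ hc
    have hgeom := congrArg v (mul_neg_geom_sum ζ (p ^ m))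
    have hne : ∑ i ∈ Finset.range (p ^ m), ζ ^ i ≠ 0 := by
      intro h
      rw [map_one_sub_pow_prime_pow_eq hζ hvp, h, mul_zero, v.map_zero] at hgeom
      exact absurd hgeom WithTop.top_ne_coe
    obtain ⟨s, hs⟩ := AddValuation.exists_eq_coe (v := v) hne
    rw [map_one_sub_pow_prime_pow_eq hζ hvp, AddValuation.map_mul_eq_coe (k := 1) hv1 hs,
      WithTop.coe_inj] at hgeom
    rw [hs, WithTop.coe_le_coe]
    omega
  · refine IsUnit.mul ?_ ht
    rw [PadicInt.isUnit_iff, PadicInt.norm_natCast_eq_one_iff]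
    exact (Nat.coprime_self_sub_right hp.one_le).2 (Nat.coprime_one_right p)
  · rw [← Algebra.trace_trace (S := E), ← Algebra.smul_def, map_smul, htr, smul_eq_mul, mul_comm]
    have h1 : (p : E) ^ m * (p - 1) = algebraMap ℚ_[p] E (p ^ m * (p - 1)) := by simp
    rw [h1, ← Algebra.smul_def, map_smul, hct, smul_eq_mul]
    push_cast [Nat.cast_sub hp.one_le]
    ring

end CyclotomicTrace

section NonNorm

variable {p : ℕ} [Fact p.Prime]

lemma PadicInt.pow_dvd_pow_prime_pow_sub_one (hp : Odd p) {x : ℤ_[p]} {j : ℕ} (hj : 1 ≤ j)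
    (h : (p : ℤ_[p]) ^ j ∣ x - 1) (n : ℕ) : (p : ℤ_[p]) ^ (j + n) ∣ x ^ p ^ n - 1 := by
  have h1 : (p : ℤ_[p]) ∣ x - 1 := (dvd_pow_self _ (by omega)).trans h
  have h2 : ¬ (p : ℤ_[p]) ∣ x := by
    intro h3
    have h4 := dvd_sub h3 h1
    rw [sub_sub_cancel] at h4
    exact PadicInt.prime_p.not_isUnit (isUnit_of_dvd_one h4)
  have h3 := emultiplicity_pow_prime_pow_sub_pow_prime_pow (R := ℤ_[p]) (x := x) (y := 1)
    PadicInt.prime_p hp h1 h2 n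
  rw [one_pow] at h3
  rw [pow_dvd_iff_le_emultiplicity] at h ⊢
  rw [h3]
  push_cast
  gcongr

lemma exists_norm_eq_of_isPrimitiveRoot {F K : Type*} [Field F] [Field K] [Algebra ℚ_[p] F]
    [Algebra F K] [Algebra ℚ_[p] K] [IsScalarTower ℚ_[p] F K] [FiniteDimensional ℚ_[p] F]
    [FiniteDimensional F K] (hp2 : p ≠ 2) {m : ℕ} {y : K} (hy : IsPrimitiveRoot y (p ^ (m + 1)))
    {z : K} (hz : z ≠ 0) : ∃ (r : ℤ) (w : ℤ_[p]), Algebra.norm ℚ_[p] (Algebra.norm F z) =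
      (p : ℚ_[p]) ^ r * ((1 + p ^ (m + 1) * w : ℤ_[p]) : ℚ_[p]) := by
  have : NeZero (p ^ (m + 1)) := ⟨pow_ne_zero _ (Fact.out : p.Prime).ne_zero⟩
  have : FiniteDimensional ℚ_[p] K := FiniteDimensional.trans ℚ_[p] F K
  have := hy.intermediateField_adjoin_isCyclotomicExtension ℚ_[p]
  rw [Algebra.norm_norm,
    ← Algebra.norm_norm (R := ℚ_[p]) (S := IntermediateField.adjoin ℚ_[p] {y})]
  exact exists_norm_eq_zpow_mul (m := m) hp2 (Algebra.norm_ne_zero_iff.mpr hz)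

variable {F : Type*} [Field F] {v : AddValuation F (WithTop ℤ)} [Algebra ℚ_[p] F]
  [FiniteDimensional ℚ_[p] F]

lemma exists_norm_one_add_prime_pow_mul_eq {e : ℤ} (he : 0 < e) (hvp : v (p : F) = e) {a : F}
    (ha : 0 ≤ v a) {T : ℤ_[p]} (hT : Algebra.trace ℚ_[p] F a = T) (j : ℕ) :
    ∃ b : ℤ_[p], Algebra.norm ℚ_[p] (1 + p ^ j * a) =
      ((1 + T * p ^ j + b * (p ^ j) ^ 2 : ℤ_[p]) : ℚ_[p]) := by
  let : Algebra ℤ_[p] F := ((algebraMap ℚ_[p] F).comp (algebraMap ℤ_[p] ℚ_[p])).toAlgebra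
  have : IsScalarTower ℤ_[p] ℚ_[p] F := IsScalarTower.of_algebraMap_eq fun _ => rfl
  let B := integralClosure ℤ_[p] F
  have : Module.Finite ℤ_[p] B := IsIntegralClosure.finite ℤ_[p] ℚ_[p] F B
  have : Module.Free ℤ_[p] B := by
    have : Module.IsTorsionFree ℤ_[p] F := Module.IsTorsionFree.trans_faithfulSMul ℤ_[p] ℚ_[p] F
    exact IsIntegralClosure.module_free ℤ_[p] ℚ_[p] F B
  have : IsLocalization (Algebra.algebraMapSubmonoid B (nonZeroDivisors ℤ_[p])) F :=
    IsIntegralClosure.isLocalization ℤ_[p] ℚ_[p] F B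
  let a' : B := ⟨a, (isIntegral_iff_nonneg he hvp a).2 ha⟩
  obtain ⟨b, hb⟩ := Algebra.norm_one_add_smul ((p : ℤ_[p]) ^ j) a'
  refine ⟨b, ?_⟩
  have h1 : Algebra.trace ℤ_[p] B a' = T := by
    apply FaithfulSMul.algebraMap_injective ℤ_[p] ℚ_[p]
    rw [← Algebra.trace_localization ℤ_[p] (nonZeroDivisors ℤ_[p]) (Rₘ := ℚ_[p]) (Sₘ := F) a']
    exact hT
  rw [h1] at hb
  rw [← hb]
  have h2 := Algebra.norm_localization ℤ_[p] (nonZeroDivisors ℤ_[p]) (Rₘ := ℚ_[p]) (Sₘ := F)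
    (1 + (p : ℤ_[p]) ^ j • a')
  rw [map_add, map_one, Algebra.smul_def, map_mul, ← IsScalarTower.algebraMap_apply, map_pow,
    map_natCast] at h2
  exact h2

/-- There are elements close to `1` whose norm to `ℚ_[p]` is not, up to a power of `p`,
congruent to `1` modulo `p ^ (m + 1 + k)`. -/
lemma exists_norm_ne_zpow_mul (hp : Odd p) {m k : ℕ} (hk : 1 ≤ k)
    (hvp : v (p : F) = (((p : ℤ) ^ m * ((p : ℤ) - 1) : ℤ) : WithTop ℤ))
    (ha : ∃ a : F, (((p : ℤ) ^ m - 1 : ℤ) : WithTop ℤ) ≤ v a ∧ ∃ t : ℤ_[p], IsUnit t ∧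
      Algebra.trace ℚ_[p] F a = (((p : ℤ_[p]) ^ m * t : ℤ_[p]) : ℚ_[p])) :
    ∃ u : F, v u = 0 ∧ (((p : ℤ) ^ m * (k * ((p : ℤ) - 1) + 1) - 1 : ℤ) : WithTop ℤ) ≤ v (u - 1) ∧
      ∀ (r : ℤ) (w : ℤ_[p]), Algebra.norm ℚ_[p] u ≠
        (p : ℚ_[p]) ^ r * ((1 + p ^ (m + k + 1) * w : ℤ_[p]) : ℚ_[p]) := by
  have hp' : p.Prime := Fact.out
  have hp3 : (3 : ℤ) ≤ p := by
    have := hp'.two_le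
    have : p ≠ 2 := by rintro rfl; exact absurd hp (by decide)
    omega
  have hP : (1 : ℤ) ≤ (p : ℤ) ^ m := one_le_pow₀ (by omega)
  have hk' : (1 : ℤ) ≤ k := by exact_mod_cast hk
  set P : ℤ := (p : ℤ) ^ m with hPdef
  set e : ℤ := P * ((p : ℤ) - 1) with he_def
  have he : 2 ≤ e := by nlinarith
  obtain ⟨a, hav, t, ht, hat⟩ := ha
  have hb : e + P - 1 ≤ k * e + P - 1 := by nlinarith
  have hJ : ((k * e + P - 1 + (m + 1 : ℕ) * e : ℤ) : WithTop ℤ) ≤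
      v (1 + p ^ (m + k + 1) * a - 1) := by
    rw [add_sub_cancel_left]
    convert AddValuation.le_map_mul (AddValuation.map_pow_eq_coe hvp (m + k + 1)).ge hav using 2
    push_cast
    ring
  obtain ⟨u, hu, huv⟩ := exists_pow_prime_pow_eq (by omega) hvp (by omega) (by nlinarith) (m + 1) hJ
  refine ⟨u, ?_, ?_, fun r w hr => ?_⟩
  · have h1 : v 1 < v (u - 1) := by
      refine lt_of_lt_of_le ?_ huv
      rw [v.map_one, ← WithTop.coe_zero, WithTop.coe_lt_coe]
      omega
    rw [← add_sub_cancel 1 u, v.map_add_eq_of_lt_left h1, v.map_one]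
  · convert huv using 2
    rw [he_def]
    ring
  have ha0 : 0 ≤ v a := le_trans (by rw [← WithTop.coe_zero, WithTop.coe_le_coe]; omega) hav
  obtain ⟨b, hb'⟩ := exists_norm_one_add_prime_pow_mul_eq (by omega) hvp ha0 hat (m + k + 1)
  rw [← hu, map_pow, hr, mul_pow] at hb'
  have hunit (x : ℤ_[p]) : ‖(1 + p ^ (m + k + 1) * x : ℤ_[p])‖ = 1 := by
    rw [← PadicInt.isUnit_iff]
    by_contra h
    have h1 : (p : ℤ_[p]) ∣ 1 + p ^ (m + k + 1) * x := by
      rw [← PadicInt.norm_lt_one_iff_dvd]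
      exact lt_of_le_of_ne (PadicInt.norm_le_one _) (mt PadicInt.isUnit_iff.2 h)
    have h2 : (p : ℤ_[p]) ∣ 1 := by
      rwa [dvd_add_left] at h1
      exact dvd_mul_of_dvd_left (dvd_pow_self _ (by omega)) _
    exact PadicInt.prime_p.not_isUnit (isUnit_of_dvd_one h2)
  have hr0 : ((p : ℚ_[p]) ^ r) ^ p ^ (m + 1) = 1 := by
    have h1 := congrArg norm hb'
    rw [show 1 + (p : ℤ_[p]) ^ m * t * p ^ (m + k + 1) + b * (p ^ (m + k + 1)) ^ 2 =
      1 + p ^ (m + k + 1) * (p ^ m * t + b * p ^ (m + k + 1)) by ring, norm_mul,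
      norm_pow _ (p ^ (m + 1)), norm_pow _ (p ^ (m + 1)), ← PadicInt.norm_def, ← PadicInt.norm_def,
      hunit, hunit, one_pow, mul_one,
      pow_eq_one_iff_of_nonneg (norm_nonneg _) (pow_pos hp'.pos _).ne', Padic.norm_p_zpow] at h1
    have h2 : r = 0 := by
      have := (zpow_eq_one_iff_right₀ (by positivity) (by exact_mod_cast hp'.one_lt.ne')).1 h1
      omega
    rw [h2, zpow_zero, one_pow]
  rw [hr0, one_mul, ← PadicInt.coe_pow] at hb'
  replace hb' := PadicInt.ext hb'
  have hdvd := PadicInt.pow_dvd_pow_prime_pow_sub_one hp (x := 1 + p ^ (m + k + 1) * w)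
    (j := m + k + 1) (by omega) (by rw [add_sub_cancel_left]; exact dvd_mul_right _ _) (m + 1)
  rw [hb'] at hdvd
  have h1 : (p : ℤ_[p]) ^ (m + k + 1 + (m + 1)) ∣ b * (p ^ (m + k + 1)) ^ 2 := by
    rw [← pow_mul]
    exact dvd_mul_of_dvd_right (pow_dvd_pow _ (by omega)) _
  have h2 : (p : ℤ_[p]) ^ (m + k + 1 + (m + 1)) ∣ p ^ m * t * p ^ (m + k + 1) := by
    rwa [add_assoc (1 : ℤ_[p]), add_sub_cancel_left, dvd_add_left h1] at hdvd
  have h3 : (p : ℤ_[p]) ∣ t := by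
    obtain ⟨c, hc⟩ := h2
    refine ⟨c, ?_⟩
    have hp0 : (p : ℤ_[p]) ^ (m + k + 1 + m) ≠ 0 := pow_ne_zero _ PadicInt.prime_p.ne_zero
    apply mul_left_cancel₀ hp0
    linear_combination hc
  exact PadicInt.prime_p.not_isUnit (isUnit_of_dvd_unit h3 ht)

end NonNorm

lemma IsPrimitiveRoot.isCyclotomicExtension_of_adjoin_eq_top {E F : Type*} [Field E] [Field F]
    [Algebra E F] {N : ℕ} [NeZero N] {ζ : F} (hζ : IsPrimitiveRoot ζ N)
    (hF : IntermediateField.adjoin E {ζ} = ⊤) : IsCyclotomicExtension {N} E F := by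
  have hintegral : IsIntegral E ζ := (hζ.isIntegral (NeZero.pos N)).tower_top
  have : IsCyclotomicExtension {N} E (IntermediateField.adjoin E {ζ}) := by
    change IsCyclotomicExtension {N} E (IntermediateField.adjoin E {ζ}).toSubalgebra
    rw [IntermediateField.adjoin_simple_toSubalgebra_of_isAlgebraic hintegral.isAlgebraic]
    exact hζ.adjoin_isCyclotomicExtension E
  rw [hF] at this
  exact IsCyclotomicExtension.equiv {N} E (⊤ : IntermediateField E F) IntermediateField.topEquiv

end Conductor

/-- For a nonzero integer `δ` with `d = v_p(δ) ≤ n - 1`, the conductor of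
`F((ζ_{p^n}^δ)^{1/p^n})/F` is `p^{n-1}·((n-d)(p-1) + 1)`. -/
theorem conductor_of_zeta_pow (p n : ℕ) [Fact p.Prime] (hp : Odd p) (hn : 1 ≤ n)
    (E F : Type) [Field E] [Field F] [Algebra ℚ_[p] E] [Algebra E F]
    [Algebra ℚ_[p] F] [IsScalarTower ℚ_[p] E F] [FiniteDimensional ℚ_[p] E]
    (ζ : F) (hζ : IsPrimitiveRoot ζ (p ^ n))
    (hF : IntermediateField.adjoin E {ζ} = ⊤)
    (v : AddValuation F (WithTop ℤ))
    (hv1 : v (1 - ζ) = (1 : WithTop ℤ))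
    (hvp : v ((p : F)) = (((p : ℤ) ^ (n - 1) * ((p : ℤ) - 1) : ℤ) : WithTop ℤ))
    (hunram : ∀ x : E, x ≠ 0 →
      ∃ k : ℤ, v (algebraMap E F x) = ((((p : ℤ) ^ (n - 1) * ((p : ℤ) - 1)) * k : ℤ) : WithTop ℤ))
    (δ : ℤ) (hδ : δ ≠ 0) (hδ' : padicValInt p δ ≤ n - 1)
    (y : AlgebraicClosure F)
    (hy : y ^ (p ^ n) = algebraMap F (AlgebraicClosure F) (ζ ^ δ)) :
    IsLeast (condSet v y)
      (p ^ (n - 1) * ((n - padicValInt p δ) * (p - 1) + 1)) := by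
  have hp' : p.Prime := Fact.out
  have hp2 : p ≠ 2 := by
    rintro rfl
    exact absurd hp (by decide)
  obtain ⟨m, rfl⟩ := Nat.exists_eq_add_of_le' hn
  have : NeZero (p ^ (m + 1)) := ⟨pow_ne_zero _ hp'.ne_zero⟩
  have := hζ.isCyclotomicExtension_of_adjoin_eq_top hF
  simp only [Nat.add_sub_cancel] at hvp hunram hδ' ⊢
  have := IsCyclotomicExtension.finiteDimensional {p ^ (m + 1)} E F
  have : FiniteDimensional ℚ_[p] F := FiniteDimensional.trans ℚ_[p] E F
  obtain ⟨ξ, hξ, hyξ⟩ := exists_isPrimitiveRoot_pow_eq hn hζ hδ hδ' hy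
  set k := m + 1 - padicValInt p δ with hk_def
  have hk : 1 ≤ k := by omega
  have hv1' : v (1 - ξ) = (1 : WithTop ℤ) := by
    rw [AddValuation.map_one_sub_eq_of_isPrimitiveRoot hξ hζ, hv1]
  constructor
  · intro u _ hu
    refine exists_norm_eq_of_le_map_sub_one hp2 hn hξ hv1' hvp hyξ (le_trans (le_of_eq ?_) hu)
    push_cast [hp'.one_le]
    rfl
  · intro f hf
    by_contra! hlt
    obtain ⟨u, hu0, hu1, hu⟩ := exists_norm_ne_zpow_mul hp hk hvp
      (exists_trace_eq_prime_pow_mul hζ hv1 hvp hunram)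
    obtain ⟨z, hz⟩ := hf u hu0 (le_trans (by
      rw [WithTop.coe_le_coe]
      zify [hp'.one_le] at hlt
      omega) hu1)
    have hyint : IsIntegral F y := Algebra.IsIntegral.isIntegral y
    have := IntermediateField.adjoin.finiteDimensional hyint
    have hz0 : z ≠ 0 := by
      rintro rfl
      rw [Algebra.norm_zero] at hz
      rw [← hz, v.map_zero] at hu0
      exact absurd hu0 (by simp)
    have hgen : IsPrimitiveRoot (IntermediateField.AdjoinSimple.gen F y) (p ^ (m + k + 1)) := by
      rw [show m + k + 1 = m + 1 + k by ring]
      refine IsPrimitiveRoot.of_pow_prime_pow hn ?_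
      convert hξ.map_of_injective
        (algebraMap F (IntermediateField.adjoin F {y})).injective using 1
      exact Subtype.ext hyξ
    obtain ⟨r, w, hrw⟩ := exists_norm_eq_of_isPrimitiveRoot (F := F) hp2 hgen hz0
    rw [hz] at hrw
    exact hu r w hrw
end

section
/- Set K = ℚ_p(ζ_{p^n}) and L = ℚ_p(ζ_{p^{2n}}), where ζ_{p^{2n}} is a primitive p^{2n}-th root of unity with ζ_{p^{2n}}^{p^n} = ζ_{p^n}. If λ ∈ K^× satisfies N_{K/ℚ_p}(λ) = p, then λ is a norm from L, i.e., λ ∈ N_{L/K}(L^×). -/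
namespace PadicCyclotomic

open Polynomial

/-- A finite algebra over `ℤ_[p]` is `p`-adically complete. -/
theorem isAdicComplete_of_finite (p : ℕ) [Fact p.Prime] (A : Type) [CommRing A]
    [Algebra ℤ_[p] A] [Module.Finite ℤ_[p] A] :
    IsAdicComplete (Ideal.span {(p : A)}) A := by
  set I : Ideal ℤ_[p] := Ideal.span {(p : ℤ_[p])} with hI
  have hc : IsAdicComplete I ℤ_[p] := by
    rw [hI, ← PadicInt.maximalIdeal_eq_span_p]; infer_instance
  have h1 : Function.Bijective (AdicCompletion.of I A) := by
    have h := AdicCompletion.ofTensorProduct_bijective_of_finite_of_isNoetherian I A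
    let e : A ≃ₗ[ℤ_[p]] TensorProduct ℤ_[p] (AdicCompletion I ℤ_[p]) A :=
      (TensorProduct.lid ℤ_[p] A).symm ≪≫ₗ
        TensorProduct.congr (AdicCompletion.ofLinearEquiv I ℤ_[p]) (LinearEquiv.refl _ _)
    have : (AdicCompletion.of I A : A → AdicCompletion I A) =
        AdicCompletion.ofTensorProduct I A ∘ e := by
      ext x : 1
      have h : AdicCompletion.of I ℤ_[p] 1 = 1 := rfl
      simp [e, h]
    rw [this]
    exact h.comp e.bijective
  have h2 : IsAdicComplete I A := AdicCompletion.of_bijective_iff.mp h1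
  have h3 : Ideal.span {(p : A)} = I.map (algebraMap ℤ_[p] A) := by
    rw [hI, Ideal.map_span]; simp
  rw [h3]
  exact { toIsHausdorff := IsHausdorff.map_algebraMap_iff.mpr h2.toIsHausdorff
          toIsPrecomplete := IsPrecomplete.map_algebraMap_iff.mpr h2.toIsPrecomplete }

/-- If a power of `π` generates an ideal for which `A` is complete, then maps contracting
`π`-adically have fixed points. -/
theorem exists_fixedPoint {A : Type*} [CommRing A] (ϖ : A) (e : ℕ)
    [IsAdicComplete (Ideal.span {ϖ ^ e}) A] (F : A → A)
    (hF : ∀ n a b, ϖ ^ n ∣ a - b → ϖ ^ (n + 1) ∣ F a - F b) : ∃ y, F y = y := by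
  have key (n : ℕ) (a b : A) :
      a ≡ b [SMOD (Ideal.span {ϖ ^ e} ^ n • ⊤ : Ideal A)] ↔ ϖ ^ (e * n) ∣ a - b := by
    rw [SModEq.sub_mem, Ideal.span_singleton_pow, smul_eq_mul, Ideal.mul_top,
      Ideal.mem_span_singleton, pow_mul]
  have h1 (n : ℕ) : ϖ ^ n ∣ F^[n + 1] 0 - F^[n] 0 := by
    induction n with
    | zero => simp
    | succ n ih =>
      have := hF _ _ _ ih
      rwa [← Function.iterate_succ_apply' F, ← Function.iterate_succ_apply' F] at this
  have h2 (n k : ℕ) : ϖ ^ n ∣ F^[n + k] 0 - F^[n] 0 := by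
    induction k with
    | zero => simp
    | succ k ih =>
      have := dvd_add ((pow_dvd_pow ϖ (Nat.le_add_right n k)).trans (h1 (n + k))) ih
      simpa [add_assoc] using this
  obtain ⟨y, hy⟩ := IsPrecomplete.prec (I := Ideal.span {ϖ ^ e}) inferInstance
    (f := fun n => F^[e * n] 0) (fun {m n} hmn => by
      rw [key, ← neg_sub, dvd_neg]
      obtain ⟨k, rfl⟩ := Nat.exists_eq_add_of_le hmn
      rw [mul_add]
      exact h2 _ _)
  refine ⟨y, ?_⟩
  rw [← sub_eq_zero]
  refine IsHausdorff.haus (I := Ideal.span {ϖ ^ e}) inferInstance _ fun n => ?_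
  rw [key, sub_zero]
  have h3 : ϖ ^ (e * n) ∣ F^[e * n] 0 - y := (key _ _ _).mp (hy n)
  have h4 : ϖ ^ (e * n) ∣ F (F^[e * n] 0) - F y := (pow_dvd_pow ϖ (Nat.le_succ _)).trans (hF _ _ _ h3)
  have h5 := h1 (e * n)
  rw [Function.iterate_succ_apply' F] at h5
  have := dvd_add (dvd_sub h5 h4) h3
  convert this using 1
  ring

section Integers

variable {p : ℕ} [hp : Fact p.Prime] {A : Type*} [CommRing A] [IsDomain A]
  {j : ℕ} {ζ : A}

theorem associated_prime_pow (hζ : IsPrimitiveRoot ζ (p ^ (j + 1))) :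
    Associated (p : A) ((ζ - 1) ^ (p ^ j * (p - 1))) := by
  have h1 : (cyclotomic (p ^ (j + 1)) A).eval 1 = p := eval_one_cyclotomic_prime_pow j
  rw [cyclotomic_eq_prod_X_sub_primitiveRoots hζ, eval_prod] at h1
  rw [← h1, ← Nat.totient_prime_pow_succ hp.out, ← hζ.card_primitiveRoots, ← Finset.prod_const]
  refine Associated.prod _ _ _ fun μ hμ => ?_
  obtain ⟨i, -, hi, rfl⟩ := hζ.isPrimitiveRoot_iff.mp
    (isPrimitiveRoot_of_mem_primitiveRoots hμ)
  rw [eval_sub, eval_X, eval_C, ← neg_sub]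
  exact (hζ.associated_sub_one_pow_sub_one_of_coprime hi).symm.neg_left

theorem sub_one_dvd_prime (hζ : IsPrimitiveRoot ζ (p ^ (j + 1))) : ζ - 1 ∣ (p : A) :=
  (dvd_pow_self _ (Nat.mul_ne_zero (pow_ne_zero _ hp.out.ne_zero)
    (Nat.sub_ne_zero_of_lt hp.out.one_lt))).trans (associated_prime_pow hζ).symm.dvd

theorem exists_nat_sub_one_dvd_sub [Algebra ℤ_[p] A] (hζ : IsPrimitiveRoot ζ (p ^ (j + 1)))
    (hA : Algebra.adjoin ℤ_[p] {ζ} = ⊤) (a : A) : ∃ c : ℕ, ζ - 1 ∣ a - c := by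
  have ha : a ∈ Algebra.adjoin ℤ_[p] {ζ} := hA ▸ Algebra.mem_top
  induction ha using Algebra.adjoin_induction with
  | mem x hx => exact ⟨1, by rw [Set.mem_singleton_iff.mp hx, Nat.cast_one]⟩
  | algebraMap r =>
    obtain ⟨c, -, hc⟩ := PadicInt.exists_mem_range r
    rw [PadicInt.maximalIdeal_eq_span_p, Ideal.mem_span_singleton] at hc
    refine ⟨c, (sub_one_dvd_prime hζ).trans ?_⟩
    simpa using map_dvd (algebraMap ℤ_[p] A) hc
  | add x y _ _ hx hy =>
    obtain ⟨c, hc⟩ := hx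
    obtain ⟨d, hd⟩ := hy
    exact ⟨c + d, by convert dvd_add hc hd using 1; push_cast; ring⟩
  | mul x y _ _ hx hy =>
    obtain ⟨c, hc⟩ := hx
    obtain ⟨d, hd⟩ := hy
    refine ⟨c * d, ?_⟩
    convert dvd_add (hc.mul_right y) (hd.mul_left (c : A)) using 1
    push_cast
    ring

theorem isUnit_of_sub_one_dvd_sub [Algebra ℤ_[p] A] (hζ : IsPrimitiveRoot ζ (p ^ (j + 1)))
    [IsAdicComplete (Ideal.span {(p : A)}) A] {a : A} {c : ℕ} (hc : ¬ p ∣ c)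
    (h : ζ - 1 ∣ a - c) : IsUnit a := by
  have h1 : ζ - 1 ∈ (⊥ : Ideal A).jacobson := by
    have h2 : (p : A) ∈ (⊥ : Ideal A).jacobson :=
      IsAdicComplete.le_jacobson_bot _ (Ideal.mem_span_singleton_self _)
    exact Ideal.isRadical_jacobson _ ⟨_, Ideal.mem_of_dvd _ (associated_prime_pow hζ).dvd h2⟩
  have hcu : IsUnit (c : A) := by
    have : IsUnit (c : ℤ_[p]) := by
      rw [PadicInt.isUnit_iff, PadicInt.norm_natCast_eq_one_iff]
      exact (Nat.Prime.coprime_iff_not_dvd hp.out).mpr hc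
    simpa using this.map (algebraMap ℤ_[p] A)
  obtain ⟨u, hu⟩ := hcu
  obtain ⟨b, hb⟩ := h
  have h3 := Ideal.mem_jacobson_bot.mp h1 (b * ↑u⁻¹)
  have : a = ((ζ - 1) * (b * ↑u⁻¹) + 1) * u := by
    have h4 : (↑u⁻¹ : A) * u = 1 := u.inv_mul
    linear_combination hb - hu - (ζ - 1) * b * h4
  rw [this]
  exact h3.mul u.isUnit

theorem exists_eq_sub_one_pow_mul [Algebra ℤ_[p] A] (hζ : IsPrimitiveRoot ζ (p ^ (j + 1)))
    (hA : Algebra.adjoin ℤ_[p] {ζ} = ⊤) [IsAdicComplete (Ideal.span {(p : A)}) A] {a : A}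
    (ha : a ≠ 0) : ∃ (k c : ℕ) (u : A), ¬ p ∣ c ∧ ζ - 1 ∣ u - c ∧ a = (ζ - 1) ^ k * u := by
  have hfin : FiniteMultiplicity (ζ - 1) a := by
    by_contra h
    refine ha (IsHausdorff.haus (I := Ideal.span {(p : A)}) inferInstance a fun n => ?_)
    rw [SModEq.zero, Ideal.span_singleton_pow, smul_eq_mul, Ideal.mul_top,
      Ideal.mem_span_singleton]
    have h1 := (associated_prime_pow hζ).pow_pow (n := n)
    rw [← pow_mul] at h1
    exact h1.dvd.trans (FiniteMultiplicity.not_iff_forall.mp h _)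
  obtain ⟨b, hb, hb'⟩ := hfin.exists_eq_pow_mul_and_not_dvd
  obtain ⟨c, hc⟩ := exists_nat_sub_one_dvd_sub hζ hA b
  refine ⟨_, c, b, fun h => hb' ?_, hc, hb⟩
  have h2 : ζ - 1 ∣ (c : A) := (sub_one_dvd_prime hζ).trans (Nat.cast_dvd_cast h)
  simpa using dvd_add hc h2

theorem exists_one_add_X_pow_prime (p : ℕ) [hp : Fact p.Prime] (hp2 : p ≠ 2) :
    ∃ G : ℤ[X], (1 + X : ℤ[X]) ^ p =
      1 + (p : ℤ[X]) * X + (p : ℤ[X]) * X ^ 2 * G + X ^ p := by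
  have h3 : 2 < p := lt_of_le_of_ne hp.out.two_le hp2.symm
  refine ⟨∑ k ∈ Finset.Ico 2 p, ((p.choose k / p : ℕ) : ℤ[X]) * X ^ (k - 2), ?_⟩
  rw [add_comm, add_pow, Finset.sum_range_succ, Finset.range_eq_Ico,
    Finset.sum_eq_sum_Ico_succ_bot hp.out.pos, Finset.sum_eq_sum_Ico_succ_bot hp.out.one_lt,
    Finset.mul_sum]
  have : ∑ k ∈ Finset.Ico (1 + 1) p, (X : ℤ[X]) ^ k * 1 ^ (p - k) * (p.choose k : ℤ[X]) =
      ∑ k ∈ Finset.Ico 2 p, (p : ℤ[X]) * X ^ 2 * (((p.choose k / p : ℕ) : ℤ[X]) * X ^ (k - 2)) := by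
    refine Finset.sum_congr rfl fun k hk => ?_
    rw [Finset.mem_Ico] at hk
    obtain ⟨d, hd⟩ := hp.out.dvd_choose_self (by omega : k ≠ 0) hk.2
    obtain ⟨l, rfl⟩ := Nat.exists_eq_add_of_le hk.1
    rw [hd, Nat.mul_div_cancel_left _ hp.out.pos, Nat.add_sub_cancel_left, one_pow, pow_add]
    push_cast
    ring
  rw [this]
  simp only [pow_zero, pow_one, one_pow, Nat.choose_zero_right, Nat.choose_one_right,
    Nat.choose_self, Nat.cast_one]
  ring

theorem exists_pow_prime_eq (hp2 : p ≠ 2) (hζ : IsPrimitiveRoot ζ (p ^ (j + 1)))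
    [IsAdicComplete (Ideal.span {(p : A)}) A] (z : A) :
    ∃ y : A, (1 + (ζ - 1) ^ (p ^ j + 1) * y) ^ p = 1 + p * (ζ - 1) ^ (p ^ j + 1) * z := by
  obtain ⟨G, hG⟩ := exists_one_add_X_pow_prime p hp2
  have h2 : 2 ≤ p := hp.out.two_le
  set ϖ := ζ - 1
  set c := ϖ ^ (p ^ j + 1) with hc
  obtain ⟨v, hv⟩ := associated_prime_pow hζ
  have hcp : c ^ p = p * c * (ϖ * (v * ϖ ^ (p - 2))) := by
    have : (p ^ j + 1) * p = p ^ j * (p - 1) + (p ^ j + 1) + 1 + (p - 2) := by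
      obtain ⟨r, rfl⟩ := Nat.exists_eq_add_of_le h2
      rw [show 2 + r - 1 = r + 1 by omega, show 2 + r - 2 = r by omega]
      ring
    rw [hc, ← pow_mul, this, pow_add _ (_ + 1), pow_add _ _ 1, pow_add, ← hv]
    ring
  let R : A[X] := C (ϖ ^ (p ^ j)) * X ^ 2 * ((G.map (Int.castRingHom A)).comp (C c * X)) +
    C (v * ϖ ^ (p - 2)) * X ^ p
  have hcomp : IsAdicComplete (Ideal.span {ϖ ^ (p ^ j * (p - 1))}) A := by
    rw [← Ideal.span_singleton_eq_span_singleton.mpr (associated_prime_pow hζ)]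
    infer_instance
  obtain ⟨y, hy⟩ := exists_fixedPoint ϖ (p ^ j * (p - 1)) (fun y => z - ϖ * R.eval y) (by
      intro n a b h
      have h1 := h.trans (sub_dvd_eval_sub a b R)
      have h3 := (mul_dvd_mul_left ϖ h1).neg_right
      rw [pow_succ']
      convert h3 using 1
      ring)
  refine ⟨y, ?_⟩
  have h1 := congrArg (fun f => eval₂ (Int.castRingHom A) (c * y) f) hG
  simp only [eval₂_add, eval₂_mul, eval₂_pow, eval₂_X, eval₂_one, eval₂_natCast] at h1
  have h4 : R.eval y = ϖ ^ (p ^ j) * y ^ 2 * eval₂ (Int.castRingHom A) (c * y) G +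
      v * ϖ ^ (p - 2) * y ^ p := by
    simp [R, eval_comp, eval_map]
  simp only [h4] at hy
  rw [h1, mul_pow c y p, hcp]
  rw [hc] at hy ⊢
  linear_combination (-(p : A) * ϖ ^ (p ^ j + 1)) * hy

end Integers

section Kummer

variable {p : ℕ} [hp : Fact p.Prime] {K L : Type*} [Field K] [Field L] [Algebra K L]
  {a : K} {θ : L}

theorem minpoly_eq_X_pow_sub_C (hθ : θ ^ p = algebraMap K L a) (hrank : Module.finrank K L = p)
    (hadj : Algebra.adjoin K {θ} = ⊤) : minpoly K θ = X ^ p - C a := by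
  have : FiniteDimensional K L := Module.finite_of_finrank_pos (hrank ▸ hp.out.pos)
  have h_int : IsIntegral K θ := Algebra.IsIntegral.isIntegral θ
  have hmonic : (X ^ p - C a).Monic := monic_X_pow_sub_C a hp.out.ne_zero
  refine (eq_of_monic_of_dvd_of_natDegree_le (minpoly.monic h_int) hmonic
    (minpoly.dvd K θ (by simp [hθ])) ?_).symm
  rw [natDegree_X_pow_sub_C, ← hrank, ← PowerBasis.ofAdjoinEqTop_dim h_int hadj,
    PowerBasis.finrank]

theorem norm_algebraMap_sub (hp2 : p ≠ 2) (hθ : θ ^ p = algebraMap K L a)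
    (hrank : Module.finrank K L = p) (hadj : Algebra.adjoin K {θ} = ⊤) (b : K) :
    Algebra.norm K (θ - algebraMap K L b) = a - b ^ p := by
  have : FiniteDimensional K L := Module.finite_of_finrank_pos (hrank ▸ hp.out.pos)
  have h_int : IsIntegral K θ := Algebra.IsIntegral.isIntegral θ
  let pb := PowerBasis.ofAdjoinEqTop h_int hadj
  have hgen : pb.gen = θ := PowerBasis.ofAdjoinEqTop_gen h_int hadj
  have h1 : Algebra.norm K (algebraMap K L b - θ) = b ^ p - a := by
    have h2 := charpoly_leftMulMatrix pb
    rw [hgen, minpoly_eq_X_pow_sub_C hθ hrank hadj] at h2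
    have h3 := Matrix.eval_charpoly (Algebra.leftMulMatrix pb.basis θ) b
    rw [h2] at h3
    rw [Algebra.norm_eq_matrix_det pb.basis, map_sub, AlgHom.commutes]
    exact h3.symm.trans (by simp)
  rw [← neg_sub, neg_eq_neg_one_mul, map_mul, h1, ← map_one (algebraMap K L), ← map_neg,
    Algebra.norm_algebraMap, hrank, (hp.out.odd_of_ne_two hp2).neg_one_pow]
  ring

theorem trace_pow_eq_zero {ω : K} (hω : IsPrimitiveRoot ω p) (hθ : θ ^ p = algebraMap K L a)
    (hrank : Module.finrank K L = p) (hadj : Algebra.adjoin K {θ} = ⊤) {k : ℕ}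
    (hk : ¬ p ∣ k) : Algebra.trace K L (θ ^ k) = 0 := by
  have : FiniteDimensional K L := Module.finite_of_finrank_pos (hrank ▸ hp.out.pos)
  have h_int : IsIntegral K θ := Algebra.IsIntegral.isIntegral θ
  let pb := PowerBasis.ofAdjoinEqTop h_int hadj
  have hgen : pb.gen = θ := PowerBasis.ofAdjoinEqTop_gen h_int hadj
  have haev : aeval (algebraMap K L ω * θ) (minpoly K pb.gen) = 0 := by
    rw [hgen, minpoly_eq_X_pow_sub_C hθ hrank hadj, map_sub, map_pow, aeval_X, aeval_C, mul_pow,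
      hθ, ← map_pow, hω.pow_eq_one, map_one, one_mul, sub_self]
  let f : L →ₐ[K] L := pb.lift _ haev
  have hf : f θ = algebraMap K L ω * θ := by
    have := pb.lift_gen _ haev
    rwa [hgen] at this
  let g : L ≃ₐ[K] L := AlgEquiv.ofBijective f (Algebra.IsAlgebraic.algHom_bijective f)
  have h1 := Algebra.trace_eq_of_algEquiv g (θ ^ k)
  have h2 : g (θ ^ k) = (ω ^ k) • θ ^ k := by
    rw [map_pow, show g θ = f θ from rfl, hf, mul_pow, Algebra.smul_def, map_pow]
  rw [h2, map_smul, smul_eq_mul] at h1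
  by_contra h
  exact hk (hω.dvd_of_pow_eq_one k ((mul_eq_right₀ h).mp h1))

/-- Elements integral over the base have traces divisible by `p`. -/
theorem exists_trace_eq {A : Type*} [CommRing A] [Algebra A K] [Algebra A L] [IsScalarTower A K L]
    {ω : K} (hω : IsPrimitiveRoot ω p) {α : A} (hθ : θ ^ p = algebraMap A L α)
    (hrank : Module.finrank K L = p) (hadj : Algebra.adjoin K {θ} = ⊤) {y : L}
    (hy : y ∈ Algebra.adjoin A {θ}) :
    ∃ s : A, Algebra.trace K L y = algebraMap A K (p * s) := by
  rw [Algebra.adjoin_singleton_eq_range_aeval] at hy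
  obtain ⟨f, rfl⟩ := hy
  change ∃ s : A, Algebra.trace K L (aeval θ f) = algebraMap A K (p * s)
  induction f using Polynomial.induction_on' with
  | add f g hf hg =>
    obtain ⟨s, hs⟩ := hf
    obtain ⟨t, ht⟩ := hg
    exact ⟨s + t, by rw [map_add, map_add, hs, ht]; simp [mul_add]⟩
  | monomial k c =>
    have hc : aeval θ (monomial k c) = algebraMap A K c • θ ^ k := by
      rw [aeval_monomial, Algebra.smul_def, ← IsScalarTower.algebraMap_apply]
    rw [hc, map_smul]
    rw [IsScalarTower.algebraMap_apply A K L] at hθ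
    by_cases hk : p ∣ k
    · obtain ⟨m, rfl⟩ := hk
      refine ⟨c * α ^ m, ?_⟩
      rw [pow_mul, hθ, ← map_pow, Algebra.trace_algebraMap, hrank]
      simp
      ring
    · exact ⟨0, by simp [trace_pow_eq_zero hω hθ hrank hadj hk]⟩

end Kummer

section Newton

variable {p : ℕ} [hp : Fact p.Prime] {A K L : Type*} [CommRing A] [Field K] [Field L]
  [Algebra A K] [Algebra K L] [Algebra A L] [IsScalarTower A K L]

/-- By Newton's identities, an element all of whose powers have trace divisible by `p` has a
characteristic polynomial congruent to `X ^ p - N(y)` modulo `p`. -/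
theorem exists_norm_one_add_mul_eq [CharZero K] (hA : ∀ k : ℕ, 0 < k → k < p → IsUnit (k : A))
    (hrank : Module.finrank K L = p) {y : L}
    (hy : ∀ k, 0 < k → ∃ s : A, Algebra.trace K L (y ^ k) = algebraMap A K (p * s)) (c : A) :
    ∃ s : A, Algebra.norm K (1 + algebraMap A L c * y) =
      1 + algebraMap A K (c ^ p) * Algebra.norm K y + algebraMap A K (p * c * s) := by
  have : FiniteDimensional K L := Module.finite_of_finrank_pos (hrank ▸ hp.out.pos)
  let E := AlgebraicClosure K
  let x : (L →ₐ[K] E) → E := fun σ => σ y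
  let e : ℕ → E := fun k => MvPolynomial.aeval x (MvPolynomial.esymm (L →ₐ[K] E) ℤ k)
  have hcard : Fintype.card (L →ₐ[K] E) = p := by rw [AlgHom.card, hrank]
  have he0 : e 0 = 1 := by simp [e]
  have he (k : ℕ) : e k = ∑ t ∈ Finset.powersetCard k Finset.univ, ∏ i ∈ t, x i := by
    simp [e, MvPolynomial.esymm, map_sum, map_prod]
  have hs (k : ℕ) (hk : 0 < k) : ∃ s : A,
      MvPolynomial.aeval x (MvPolynomial.psum (L →ₐ[K] E) ℤ k) = algebraMap A E (p * s) := by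
    obtain ⟨s, hs⟩ := hy k hk
    refine ⟨s, ?_⟩
    rw [IsScalarTower.algebraMap_apply A K E, ← hs, trace_eq_sum_embeddings E]
    simp [MvPolynomial.psum, x]
  have hek (k : ℕ) (hk : 0 < k) (hkp : k < p) : ∃ s : A, e k = algebraMap A E (p * s) := by
    induction k using Nat.strong_induction_on with
    | _ k ih =>
    have h_int (i : ℕ) (hi : i < k) : ∃ s : A, e i = algebraMap A E s := by
      rcases Nat.eq_zero_or_pos i with rfl | hi'
      · exact ⟨1, by rw [he0, map_one]⟩
      · exact (ih i hi hi' (hi.trans hkp)).imp' (fun s => p * s) fun s hs => hs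
    have h1 := congrArg (MvPolynomial.aeval x) (MvPolynomial.mul_esymm_eq_sum (L →ₐ[K] E) ℤ k)
    have h2 : ∃ s : A, k * e k = algebraMap A E (p * s) := by
      choose! u hu using h_int
      choose! v hv using hs
      refine ⟨(-1) ^ (k + 1) * ∑ a ∈ Finset.HasAntidiagonal.antidiagonal k with a.1 < k,
        (-1) ^ a.1 * u a.1 * v a.2, ?_⟩
      rw [map_mul, map_natCast] at h1
      have h3 (i : ℕ) (hi : i < k) :
          MvPolynomial.aeval x (MvPolynomial.esymm (L →ₐ[K] E) ℤ i) = algebraMap A E (u i) :=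
        hu i hi
      change k * MvPolynomial.aeval x (MvPolynomial.esymm (L →ₐ[K] E) ℤ k) = _
      rw [h1, mul_left_comm (p : A)]
      simp only [map_mul, map_pow, map_neg, map_one, map_sum]
      rw [Finset.mul_sum _ _ (algebraMap A E p)]
      congr 1
      refine Finset.sum_congr rfl fun a ha => ?_
      rw [Finset.mem_filter, Finset.HasAntidiagonal.mem_antidiagonal] at ha
      rw [hv _ (by omega), h3 _ ha.2, map_mul]
      ring
    obtain ⟨s, hs⟩ := h2
    obtain ⟨w, hw⟩ := hA k hk hkp
    refine ⟨↑w⁻¹ * s, ?_⟩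
    have hk0 : (k : E) ≠ 0 := by
      have : CharZero E := charZero_of_injective_algebraMap (algebraMap K E).injective
      exact_mod_cast hk.ne'
    refine mul_left_cancel₀ hk0 (hs.trans ?_)
    rw [← map_natCast (algebraMap A E) k, ← map_mul, ← hw, mul_left_comm (w : A), ← mul_assoc (w : A),
      Units.mul_inv, one_mul]
  choose! s hs' using hek
  refine ⟨∑ k ∈ Finset.Ico 1 p, c ^ (k - 1) * s k, (algebraMap K E).injective ?_⟩
  have hprod : algebraMap K E (Algebra.norm K (1 + algebraMap A L c * y)) =
      ∑ k ∈ Finset.range (p + 1), algebraMap A E c ^ k * e k := by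
    rw [Algebra.norm_eq_prod_embeddings]
    have (σ : L →ₐ[K] E) : σ (1 + algebraMap A L c * y) = 1 + algebraMap A E c * x σ := by
      rw [map_add, map_one, map_mul, IsScalarTower.algebraMap_apply A K L, AlgHom.commutes,
        ← IsScalarTower.algebraMap_apply]
    rw [Finset.prod_congr rfl fun σ _ => this σ, Finset.prod_one_add, Finset.sum_powerset,
      Finset.card_univ, hcard]
    simp_rw [he, Finset.mul_sum]
    refine Finset.sum_congr rfl fun k hk => Finset.sum_congr rfl fun t ht => ?_
    rw [Finset.prod_mul_distrib, Finset.prod_const, (Finset.mem_powersetCard.mp ht).2]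
  have hep : e p = algebraMap K E (Algebra.norm K y) := by
    rw [he, ← hcard, ← Finset.card_univ, Finset.powersetCard_self, Finset.sum_singleton,
      Algebra.norm_eq_prod_embeddings]
  rw [hprod, Finset.sum_range_succ, Finset.range_eq_Ico, Finset.sum_eq_sum_Ico_succ_bot hp.out.pos,
    hep, he0, Finset.mul_sum, map_sum, map_add, map_add, map_mul, map_sum, zero_add, pow_zero]
  have : ∑ k ∈ Finset.Ico 1 p, algebraMap A E c ^ k * e k = ∑ k ∈ Finset.Ico 1 p,
      algebraMap K E (algebraMap A K (p * c * (c ^ (k - 1) * s k))) := by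
    refine Finset.sum_congr rfl fun k hk => ?_
    rw [Finset.mem_Ico] at hk
    rw [hs' k hk.1 hk.2, ← IsScalarTower.algebraMap_apply, ← map_pow, ← map_mul]
    obtain ⟨l, rfl⟩ := Nat.exists_eq_add_of_le hk.1
    rw [Nat.add_sub_cancel_left, pow_add]
    congr 1
    ring
  rw [this, ← IsScalarTower.algebraMap_apply A K E, map_one, map_pow]
  ring
end Newton

/-- The extension `L / K` obtained by adjoining a `p`-th root `θ` of a primitive
`p ^ (j + 1)`-th root of unity `ζ`, where `A = ℤ_[p][ζ]` is the ring of integers of `K`. -/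
structure IsCyclotomicStep (p j : ℕ) [Fact p.Prime] {A : Type*} (K : Type*) {L : Type*}
    [CommRing A] [Field K] [Field L] [Algebra ℤ_[p] A] [Algebra A L] [Algebra K L]
    (ζ : A) (θ : L) : Prop where
  ne_two : p ≠ 2
  primitiveRoot : IsPrimitiveRoot ζ (p ^ (j + 1))
  adjoin_eq_top : Algebra.adjoin ℤ_[p] {ζ} = ⊤
  complete : IsAdicComplete (Ideal.span {(p : A)}) A
  pow_eq : θ ^ p = algebraMap A L ζ
  finrank_eq : Module.finrank K L = p
  adjoin_field_eq_top : Algebra.adjoin K {θ} = ⊤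

/-- The multiplicative monoid of norms of an extension. -/
noncomputable def normMonoid (K L : Type*) [Field K] [Field L] [Algebra K L] : Submonoid K :=
  MonoidHom.mrange (Algebra.norm K : L →* K)

theorem norm_mem_normMonoid {K L : Type*} [Field K] [Field L] [Algebra K L] (z : L) :
    Algebra.norm K z ∈ normMonoid K L := ⟨z, rfl⟩

theorem inv_mem_normMonoid {K L : Type*} [Field K] [Field L] [Algebra K L] {x : K}
    (hx : x ∈ normMonoid K L) : x⁻¹ ∈ normMonoid K L := by
  obtain ⟨z, rfl⟩ := hx
  rcases eq_or_ne (Algebra.norm K z) 0 with h | h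
  · rw [h, inv_zero, ← h]
    exact norm_mem_normMonoid z
  · have hz := congrArg (Algebra.norm K) (mul_inv_mul_cancel z)
    rw [map_mul, map_mul, mul_assoc, mul_eq_left₀ h] at hz
    exact ⟨z⁻¹, eq_inv_of_mul_eq_one_left hz⟩

namespace IsCyclotomicStep

variable {p j : ℕ} [hp : Fact p.Prime] {A K L : Type*} [CommRing A] [Field K] [Field L]
  [Algebra ℤ_[p] A] [Algebra K L] [Algebra A L] {ζ : A} {θ : L}

theorem isUnit_one_add [IsDomain A] (h : IsCyclotomicStep p j K ζ θ) {i : ℕ} (hi : i ≠ 0) (a : A) :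
    IsUnit (1 + (ζ - 1) ^ i * a) :=
  have := h.complete
  isUnit_of_sub_one_dvd_sub h.primitiveRoot (c := 1) hp.out.not_dvd_one
    (by simpa using (dvd_pow_self _ hi).mul_right a)

variable [Algebra A K] [IsScalarTower A K L]

theorem norm_sub (h : IsCyclotomicStep p j K ζ θ) (b : A) :
    Algebra.norm K (θ - algebraMap A L b) = algebraMap A K (ζ - b ^ p) := by
  rw [IsScalarTower.algebraMap_apply A K L, norm_algebraMap_sub h.ne_two
    (h.pow_eq.trans (IsScalarTower.algebraMap_apply A K L _)) h.finrank_eq h.adjoin_field_eq_top,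
    map_sub, map_pow]

theorem norm_sub_one (h : IsCyclotomicStep p j K ζ θ) :
    Algebra.norm K (θ - 1) = algebraMap A K (ζ - 1) := by
  simpa using h.norm_sub 1

variable [IsDomain A] [IsFractionRing A K]

theorem exists_norm_eq_one_add_pow [CharZero K] (h : IsCyclotomicStep p j K ζ θ) (c : ℕ) {i m : ℕ}
    (hm : p * m ≤ i) : ∃ (w : L) (s : A),
      Algebra.norm K w = algebraMap A K (1 + c ^ p * (ζ - 1) ^ i + p * (ζ - 1) ^ m * s) := by
  have := h.complete
  let S := Algebra.adjoin A {θ}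
  let ϑ : S := ⟨θ, Algebra.self_mem_adjoin_singleton A θ⟩
  have hϑ : ϑ ^ p = algebraMap A S ζ := Subtype.ext h.pow_eq
  obtain ⟨b, hb⟩ : ∃ b : S, (ϑ - 1) ^ p = algebraMap A S (ζ - 1) * b := by
    obtain ⟨r, hr⟩ := exists_add_pow_prime_eq hp.out ϑ (-1)
    obtain ⟨v, hv⟩ := sub_one_dvd_prime h.primitiveRoot
    refine ⟨1 - algebraMap A S v * ϑ * r, ?_⟩
    have hv' := congrArg (algebraMap A S) hv
    rw [map_mul, map_natCast] at hv'
    rw [sub_eq_add_neg, hr, hϑ, (hp.out.odd_of_ne_two h.ne_two).neg_one_pow, hv', map_sub, map_one]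
    ring
  let y : S := b ^ m * (ϑ - 1) ^ (i - p * m)
  have hy : (ϑ - 1) ^ i = algebraMap A S ((ζ - 1) ^ m) * y := by
    rw [map_pow, ← mul_assoc, ← mul_pow, ← hb, ← pow_mul, ← pow_add, Nat.add_sub_cancel' hm]
  have hω : IsPrimitiveRoot (algebraMap A K (ζ ^ p ^ j)) p :=
    (h.primitiveRoot.pow (pow_pos hp.out.pos _) (pow_succ p j)).map_of_injective
      (IsFractionRing.injective A K)
  have hunit (k : ℕ) (hk : 0 < k) (hkp : k < p) : IsUnit (k : A) :=
    isUnit_of_sub_one_dvd_sub h.primitiveRoot (c := k) (Nat.not_dvd_of_pos_of_lt hk hkp) (by simp)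
  obtain ⟨s, hs⟩ := exists_norm_one_add_mul_eq (K := K) (y := (y : L)) hunit h.finrank_eq
    (fun k _ => exists_trace_eq hω h.pow_eq h.finrank_eq h.adjoin_field_eq_top
      (pow_mem y.2 k)) (c * (ζ - 1) ^ m)
  refine ⟨_, c * s, hs.trans ?_⟩
  have hN : algebraMap A K ((ζ - 1) ^ m) ^ p * Algebra.norm K (y : L) =
      algebraMap A K ((ζ - 1) ^ i) := by
    have h1 := congrArg (fun x : S => Algebra.norm K (x : L)) hy
    simp only [MulMemClass.coe_mul, SubmonoidClass.coe_pow, Subalgebra.coe_algebraMap, map_mul] at h1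
    rw [IsScalarTower.algebraMap_apply A K L, Algebra.norm_algebraMap, h.finrank_eq] at h1
    rw [← h1, map_pow, map_pow, ← h.norm_sub_one]
    rfl
  rw [mul_pow, map_mul, mul_assoc, map_pow (algebraMap A K) (_ ^ m), hN]
  simp only [map_add, map_mul, map_one, map_natCast, map_pow]
  ring

theorem exists_norm_mul_eq_one_add [CharZero K] (h : IsCyclotomicStep p j K ζ θ) {i : ℕ}
    (hi : i ≠ 0) (hi' : i + 1 < p ^ (j + 1)) (z : A) : ∃ (w : L) (z' : A),
      algebraMap A K (1 + (ζ - 1) ^ i * z) =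
        Algebra.norm K w * algebraMap A K (1 + (ζ - 1) ^ (i + 1) * z') := by
  have := h.complete
  obtain ⟨c, d, hd⟩ := exists_nat_sub_one_dvd_sub h.primitiveRoot h.adjoin_eq_top z
  obtain ⟨w, s, hw⟩ := h.exists_norm_eq_one_add_pow c (Nat.mul_div_le i p)
  have h1 : (ζ - 1) ^ (i + 1) ∣ p * (ζ - 1) ^ (i / p) := by
    have h2 := (associated_prime_pow h.primitiveRoot).symm.dvd
    have h3 : i + 1 ≤ p ^ j * (p - 1) + i / p := by
      have h4 := Nat.div_add_mod i p
      have h5 := Nat.mod_lt i hp.out.pos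
      obtain ⟨r, hr⟩ := Nat.exists_eq_add_of_le hp.out.two_le
      rw [pow_succ] at hi'
      generalize i / p = m at *
      generalize i % p = l at *
      generalize p ^ j = q at *
      subst hr
      have h6 : 2 + r - 1 = r + 1 := by omega
      rw [h6]
      have h7 : m < q := by nlinarith
      obtain ⟨u, rfl⟩ := Nat.exists_eq_add_of_lt h7
      rcases u with _ | u
      · nlinarith
      · nlinarith
    refine (pow_dvd_pow _ h3).trans ?_
    rw [pow_add]
    exact mul_dvd_mul_right h2 _
  have h2 : ζ - 1 ∣ (c : A) ^ p - c := by
    refine (sub_one_dvd_prime h.primitiveRoot).trans ?_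
    have : (p : ℤ) ∣ (c : ℤ) ^ p - c := by
      rw [← ZMod.intCast_zmod_eq_zero_iff_dvd]
      simp [ZMod.pow_card]
    simpa using map_dvd (Int.castRingHom A) this
  obtain ⟨f, hf⟩ := h1
  obtain ⟨g, hg⟩ := h2
  have hu : 1 + c ^ p * (ζ - 1) ^ i + p * (ζ - 1) ^ (i / p) * s =
      1 + (ζ - 1) ^ i * (c ^ p + (ζ - 1) * f * s) := by
    rw [hf]; ring
  obtain ⟨u, hu'⟩ := h.isUnit_one_add hi (c ^ p + (ζ - 1) * f * s)
  rw [hu, ← hu'] at hw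
  refine ⟨w, ↑u⁻¹ * (d - g - f * s), ?_⟩
  rw [hw, ← map_mul, mul_add, mul_left_comm, ← mul_assoc (u : A), Units.mul_inv, hu', one_mul, mul_one]
  congr 1
  linear_combination (ζ - 1) ^ i * (hd - hg)

theorem exists_norm_mul_eq_one_add_mul [CharZero K] (h : IsCyclotomicStep p j K ζ θ) (z : A) :
    ∃ (w : L) (z' : A), algebraMap A K (1 + (ζ - 1) * z) =
      Algebra.norm K w * algebraMap A K (1 + (ζ - 1) ^ (p ^ (j + 1) - 1) * z') := by
  have key (i : ℕ) (hi : i + 2 ≤ p ^ (j + 1)) : ∃ (w : L) (z' : A),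
      algebraMap A K (1 + (ζ - 1) * z) =
        Algebra.norm K w * algebraMap A K (1 + (ζ - 1) ^ (i + 1) * z') := by
    induction i with
    | zero => exact ⟨1, z, by simp⟩
    | succ i ih =>
      obtain ⟨w, z', hw⟩ := ih (by omega)
      obtain ⟨v, z'', hv⟩ := h.exists_norm_mul_eq_one_add i.succ_ne_zero (by omega) z'
      exact ⟨w * v, z'', by rw [hw, hv, map_mul, mul_assoc]⟩
  have h2 : 2 ≤ p ^ (j + 1) := hp.out.two_le.trans (Nat.le_self_pow j.succ_ne_zero p)
  have := key (p ^ (j + 1) - 2) (by omega)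
  rwa [show p ^ (j + 1) - 2 + 1 = p ^ (j + 1) - 1 by omega] at this

theorem one_add_mem_normMonoid (h : IsCyclotomicStep p j K ζ θ) (z : A) :
    algebraMap A K (1 + (ζ - 1) ^ p ^ (j + 1) * z) ∈ normMonoid K L := by
  have := h.complete
  obtain ⟨v, hv⟩ := associated_prime_pow h.primitiveRoot
  obtain ⟨b, hb⟩ := exists_pow_prime_eq h.ne_two h.primitiveRoot (-(v * z))
  have h1 : p ^ (j + 1) = p ^ j * (p - 1) + p ^ j := by
    rw [pow_succ, ← Nat.mul_add_one, Nat.sub_add_cancel hp.out.one_le]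
  have h2 := h.norm_sub (1 + (ζ - 1) ^ (p ^ j + 1) * b)
  have h3 : ζ - (1 + (ζ - 1) ^ (p ^ j + 1) * b) ^ p =
      (ζ - 1) * (1 + (ζ - 1) ^ p ^ (j + 1) * z) := by
    rw [hb, h1, pow_add _ (p ^ j * (p - 1)), ← hv]
    ring
  have h4 : algebraMap A K (ζ - 1) ≠ 0 := by
    rw [Ne, map_eq_zero_iff _ (IsFractionRing.injective A K), sub_eq_zero]
    exact h.primitiveRoot.ne_one (Nat.one_lt_pow j.succ_ne_zero hp.out.one_lt)
  rw [h3, map_mul] at h2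
  rw [← inv_mul_cancel_left₀ h4 (algebraMap A K (1 + _)), ← h2, ← h.norm_sub_one]
  exact mul_mem (inv_mem_normMonoid (norm_mem_normMonoid _)) (norm_mem_normMonoid _)

end IsCyclotomicStep

namespace IsCyclotomicStep

variable {p j : ℕ} [hp : Fact p.Prime] {A K L : Type*} [CommRing A] [IsDomain A] [Field K] [Field L]
  [Algebra ℤ_[p] A] [Algebra K L] [Algebra A L] {ζ : A} {θ : L}

theorem sub_one_dvd_map_sub (h : IsCyclotomicStep p j K ζ θ) {τ : A →+* A} {s : ℕ}
    (hτ : τ ζ = ζ ^ s) (a : A) : ζ - 1 ∣ τ a - a := by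
  obtain ⟨c, hc⟩ := exists_nat_sub_one_dvd_sub h.primitiveRoot h.adjoin_eq_top a
  have h1 : ζ - 1 ∣ τ a - c := by
    refine (sub_one_dvd_pow_sub_one ζ s).trans ?_
    simpa [hτ] using map_dvd τ hc
  simpa using dvd_sub h1 hc

theorem exists_map_one_add_eq (h : IsCyclotomicStep p j K ζ θ) {τ : A →+* A} {s : ℕ}
    (hτ : τ ζ = ζ ^ s) (hs : ¬ p ∣ s) (a : A) : ∃ b : A,
      τ (1 + (ζ - 1) ^ (p ^ (j + 1) - 1) * a) =
        (1 + (ζ - 1) ^ (p ^ (j + 1) - 1) * a) * (1 + (ζ - 1) ^ p ^ (j + 1) * b) := by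
  set t := p ^ (j + 1) - 1 with ht
  have h2 : 2 ≤ p ^ (j + 1) := hp.out.two_le.trans (Nat.le_self_pow j.succ_ne_zero p)
  have ht' : p ^ (j + 1) = t + 1 := by omega
  set g := ∑ k ∈ Finset.range s, ζ ^ k with hg
  have h3 : ζ ^ s - 1 = (ζ - 1) * g := by rw [mul_comm, geom_sum_mul]
  have h4 : ζ - 1 ∣ g - s := by
    rw [hg, ← Finset.card_range s, Finset.cast_card, Finset.card_range, ← Finset.sum_sub_distrib]
    exact Finset.dvd_sum fun k _ => sub_one_dvd_pow_sub_one ζ k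
  have h5 : ζ - 1 ∣ (s : A) ^ t - 1 := by
    refine (sub_one_dvd_prime h.primitiveRoot).trans ?_
    have : (p : ℤ) ∣ (s : ℤ) ^ t - 1 := by
      rw [← ZMod.intCast_zmod_eq_zero_iff_dvd]
      have h6 : (s : ZMod p) ≠ 0 := by rwa [Ne, ZMod.natCast_eq_zero_iff]
      have h7 : (s : ZMod p) ^ t = 1 := by
        refine mul_right_cancel₀ h6 ?_
        rw [← pow_succ, ← ht', ZMod.pow_card_pow, one_mul]
      simp [h7]
    simpa using map_dvd (Int.castRingHom A) this
  have h6 : ζ - 1 ∣ g ^ t * τ a - a := by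
    have h7 := (h4.trans (sub_dvd_pow_sub_pow g s t))
    have h8 := h.sub_one_dvd_map_sub hτ a
    convert dvd_add (dvd_add (h7.mul_right (τ a)) (h5.mul_right (τ a))) h8 using 1
    ring
  obtain ⟨d, hd⟩ := h6
  obtain ⟨u, hu⟩ := h.isUnit_one_add (by omega : t ≠ 0) a
  refine ⟨↑u⁻¹ * d, ?_⟩
  rw [mul_add, mul_one, ← hu, mul_left_comm, ← mul_assoc (u : A), Units.mul_inv, hu, one_mul, map_add, map_one,
    map_mul, map_pow, map_sub, map_one, hτ, h3, ht', mul_pow]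
  linear_combination (ζ - 1) ^ t * hd

variable [Algebra A K] [IsScalarTower A K L] [IsFractionRing A K] [CharZero K]

/-- Ratios of conjugates over `ℚ_p` are norms. -/
theorem map_div_mem_normMonoid (h : IsCyclotomicStep p j K ζ θ) {τ : A →+* A} {s : ℕ}
    (hτ : τ ζ = ζ ^ s) (hs : ¬ p ∣ s) (σ : K ≃+* K)
    (hσ : ∀ a, σ (algebraMap A K a) = algebraMap A K (τ a))
    (hσN : ∀ x ∈ normMonoid K L, σ x ∈ normMonoid K L) {x : K}
    (hx : x ≠ 0) : σ x / x ∈ normMonoid K L := by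
  have := h.complete
  have hmul {x y : K} (hx : σ x / x ∈ normMonoid K L) (hy : σ y / y ∈ normMonoid K L) :
      σ (x * y) / (x * y) ∈ normMonoid K L := by
    rw [map_mul, mul_div_mul_comm]
    exact mul_mem hx hy
  have hnorm (z : L) : σ (Algebra.norm K z) / Algebra.norm K z ∈ normMonoid K L := by
    rw [div_eq_mul_inv]
    exact mul_mem (hσN _ (norm_mem_normMonoid z)) (inv_mem_normMonoid (norm_mem_normMonoid z))
  have hinj := IsFractionRing.injective A K
  have hinv {a : A} (ha : IsUnit a) : algebraMap A K a ≠ 0 := by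
    rw [Ne, map_eq_zero_iff _ hinj]
    exact ha.ne_zero
  have hunit (z : A) : σ (algebraMap A K (1 + (ζ - 1) * z)) / algebraMap A K (1 + (ζ - 1) * z) ∈
      normMonoid K L := by
    obtain ⟨w, z', hw⟩ := h.exists_norm_mul_eq_one_add_mul z
    rw [hw]
    refine hmul (hnorm w) ?_
    obtain ⟨b, hb⟩ := h.exists_map_one_add_eq hτ hs z'
    have h2 : 2 ≤ p ^ (j + 1) := hp.out.two_le.trans (Nat.le_self_pow j.succ_ne_zero p)
    rw [hσ, hb, map_mul, mul_div_cancel_left₀ _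
      (hinv (h.isUnit_one_add (by omega : p ^ (j + 1) - 1 ≠ 0) z'))]
    exact h.one_add_mem_normMonoid b
  have h_int {a : A} (ha : a ≠ 0) : σ (algebraMap A K a) / algebraMap A K a ∈ normMonoid K L := by
    obtain ⟨k, c, u, hc, hu, rfl⟩ :=
      exists_eq_sub_one_pow_mul h.primitiveRoot h.adjoin_eq_top ha
    rw [map_mul, map_pow, ← h.norm_sub_one, ← map_pow]
    refine hmul (hnorm _) ?_
    obtain ⟨v, hv⟩ := isUnit_of_sub_one_dvd_sub (a := (c : A)) h.primitiveRoot hc (by simp)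
    obtain ⟨d, hd⟩ := hu
    have h3 : u = c * (1 + (ζ - 1) * (↑v⁻¹ * d)) := by
      rw [mul_add, ← hv, mul_left_comm, ← mul_assoc (v : A), Units.mul_inv, hv]
      linear_combination hd
    rw [h3, map_mul]
    refine hmul ?_ (hunit _)
    rw [map_natCast, map_natCast, div_self]
    · exact one_mem _
    · rw [← map_natCast (algebraMap A K)]
      exact hinv (hv ▸ v.isUnit)
  obtain ⟨a, b, hb, rfl⟩ := IsFractionRing.div_surjective (A := A) x
  have ha : a ≠ 0 := by
    rintro rfl
    simp at hx
  rw [map_div₀, div_div_div_comm, div_eq_mul_inv (_ / _)]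
  exact mul_mem (h_int ha) (inv_mem_normMonoid (h_int (nonZeroDivisors.ne_zero hb)))

end IsCyclotomicStep

theorem irreducible_cyclotomic (p : ℕ) [hp : Fact p.Prime] (j : ℕ) :
    Irreducible (cyclotomic (p ^ (j + 1)) ℚ_[p]) := by
  have h0 : p ^ (j + 1) ≠ 0 := pow_ne_zero _ hp.out.ne_zero
  rw [← map_cyclotomic (p ^ (j + 1)) (algebraMap ℤ_[p] ℚ_[p]),
    ← (cyclotomic.monic _ ℤ_[p]).irreducible_iff_irreducible_map_fraction_map]
  rw [← MulEquiv.irreducible_iff (algEquivAevalXAddC (1 : ℤ_[p]))]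
  have hmonic : ((cyclotomic (p ^ (j + 1)) ℤ_[p]).comp (X + C 1)).Monic :=
    (cyclotomic.monic _ _).comp_X_add_C 1
  have hE : ((cyclotomic (p ^ (j + 1)) ℤ_[p]).comp (X + C 1)).IsEisensteinAt
      (Ideal.span {(p : ℤ_[p])}) := by
    have hZ := cyclotomic_prime_pow_comp_X_add_one_isEisensteinAt p j
    have hmap : (cyclotomic (p ^ (j + 1)) ℤ_[p]).comp (X + C 1) =
        ((cyclotomic (p ^ (j + 1)) ℤ).comp (X + 1)).map (Int.castRingHom ℤ_[p]) := by
      simp [Polynomial.map_comp]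
    have hdeg : ((cyclotomic (p ^ (j + 1)) ℤ_[p]).comp (X + C 1)).natDegree =
        ((cyclotomic (p ^ (j + 1)) ℤ).comp (X + 1)).natDegree := by
      rw [natDegree_comp, ← C_1, natDegree_comp, natDegree_X_add_C, natDegree_X_add_C,
        natDegree_cyclotomic, natDegree_cyclotomic]
    refine hmonic.isEisensteinAt_of_mem_of_notMem ?_ (fun {n} hn => ?_) ?_
    · rw [← PadicInt.maximalIdeal_eq_span_p]
      exact Ideal.IsPrime.ne_top'
    · have := hZ.mem (hdeg ▸ hn)
      rw [Ideal.submodule_span_eq, Ideal.mem_span_singleton] at this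
      rw [hmap, coeff_map, Ideal.mem_span_singleton]
      simpa using map_dvd (Int.castRingHom ℤ_[p]) this
    · rw [coeff_zero_eq_eval_zero, eval_comp]
      simp only [eval_add, eval_X, eval_C, zero_add]
      rw [eval_one_cyclotomic_prime_pow, Ideal.span_singleton_pow, Ideal.mem_span_singleton]
      intro h
      rw [pow_two] at h
      have := PadicInt.prime_p (p := p)
      exact this.not_isUnit (isUnit_of_dvd_one ((mul_dvd_mul_iff_left this.ne_zero).mp (by simpa using h)))
  have := hE.irreducible (by rw [← PadicInt.maximalIdeal_eq_span_p]; infer_instance)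
    hmonic.isPrimitive (by
      rw [natDegree_comp, natDegree_X_add_C, mul_one, natDegree_cyclotomic]
      exact Nat.totient_pos.mpr (Nat.pos_of_ne_zero h0))
  simpa [algEquivAevalXAddC, comp, aeval_def] using this

section

variable {p : ℕ} [hp : Fact p.Prime] {K : Type*} [Field K] [Algebra ℚ_[p] K]
  [Algebra ℤ_[p] K] [IsScalarTower ℤ_[p] ℚ_[p] K] {ζ : K}

theorem exists_pow_mul_mem_adjoin {x : K} (hx : x ∈ Algebra.adjoin ℚ_[p] {ζ}) :
    ∃ k : ℕ, (p : K) ^ k * x ∈ Algebra.adjoin ℤ_[p] {ζ} := by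
  have hnat (k : ℕ) : (p : K) ^ k ∈ Algebra.adjoin ℤ_[p] {ζ} :=
    pow_mem (natCast_mem _ p) k
  induction hx using Algebra.adjoin_induction with
  | mem x hx => exact ⟨0, by simpa using Algebra.subset_adjoin hx⟩
  | algebraMap r =>
    obtain ⟨⟨a, b⟩, hab⟩ := IsLocalization.surj (nonZeroDivisors ℤ_[p]) r
    obtain ⟨k, u, hu⟩ : ∃ (k : ℕ) (u : ℤ_[p]ˣ), (b : ℤ_[p]) = u * (p : ℤ_[p]) ^ k :=
      ⟨_, _, PadicInt.unitCoeff_spec (nonZeroDivisors.ne_zero b.2)⟩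
    refine ⟨k, ?_⟩
    have h1 : (p : K) ^ k * algebraMap ℚ_[p] K r = algebraMap ℤ_[p] K (↑u⁻¹ * a) := by
      have h2 : (p : ℚ_[p]) ^ k * r = algebraMap ℤ_[p] ℚ_[p] (↑u⁻¹ * a) := by
        rw [map_mul, ← hab]
        simp only [hu, map_mul, map_pow, map_natCast]
        rw [mul_left_comm r, ← mul_assoc (algebraMap ℤ_[p] ℚ_[p] _), ← map_mul, Units.inv_mul,
          map_one, one_mul, mul_comm]
      rw [IsScalarTower.algebraMap_apply ℤ_[p] ℚ_[p] K, ← h2]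
      simp
    rw [h1]
    exact Subalgebra.algebraMap_mem _ _
  | add x y _ _ hx hy =>
    obtain ⟨k, hk⟩ := hx
    obtain ⟨l, hl⟩ := hy
    refine ⟨k + l, ?_⟩
    convert add_mem (mul_mem (hnat l) hk) (mul_mem (hnat k) hl) using 1
    ring
  | mul x y _ _ hx hy =>
    obtain ⟨k, hk⟩ := hx
    obtain ⟨l, hl⟩ := hy
    refine ⟨k + l, ?_⟩
    convert mul_mem hk hl using 1
    ring

theorem isFractionRing_adjoin (h : Algebra.adjoin ℚ_[p] {ζ} = ⊤) :
    IsFractionRing (Algebra.adjoin ℤ_[p] {ζ}) K := by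
  have : CharZero K := charZero_of_injective_algebraMap (algebraMap ℚ_[p] K).injective
  refine IsFractionRing.of_field _ _ fun x => ?_
  obtain ⟨k, hk⟩ := exists_pow_mul_mem_adjoin (h ▸ Algebra.mem_top : x ∈ Algebra.adjoin ℚ_[p] {ζ})
  refine ⟨⟨_, hk⟩, (p : Algebra.adjoin ℤ_[p] {ζ}) ^ k, ?_⟩
  have : (p : K) ≠ 0 := Nat.cast_ne_zero.mpr hp.out.ne_zero
  simp [this]

end

section Step

variable {p : ℕ} [hp : Fact p.Prime] (j : ℕ) {K L : Type} [Field K] [Field L] [Algebra ℚ_[p] K]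
  [Algebra ℚ_[p] L] [Algebra K L] [IsScalarTower ℚ_[p] K L]

theorem finrank_eq_prime [IsCyclotomicExtension {p ^ (j + 1)} ℚ_[p] K]
    [IsCyclotomicExtension {p ^ (j + 2)} ℚ_[p] L] : Module.finrank K L = p := by
  have hne : NeZero (p ^ (j + 1)) := ⟨pow_ne_zero _ hp.out.ne_zero⟩
  have hne' : NeZero (p ^ (j + 2)) := ⟨pow_ne_zero _ hp.out.ne_zero⟩
  have h1 := IsCyclotomicExtension.finrank K (irreducible_cyclotomic p j)
  have h2 := IsCyclotomicExtension.finrank L (irreducible_cyclotomic p (j + 1))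
  rw [Nat.totient_prime_pow_succ hp.out] at h1 h2
  have h3 := Module.finrank_mul_finrank ℚ_[p] K L
  refine mul_left_cancel₀ (mul_ne_zero (pow_ne_zero j hp.out.ne_zero)
    (Nat.sub_ne_zero_of_lt hp.out.one_lt)) ?_
  rw [← h1, h3, h2, h1, pow_succ, mul_right_comm]

theorem isCyclotomicStep [IsCyclotomicExtension {p ^ (j + 1)} ℚ_[p] K]
    [IsCyclotomicExtension {p ^ (j + 2)} ℚ_[p] L]
    [Algebra ℤ_[p] K] [IsScalarTower ℤ_[p] ℚ_[p] K] (hp2 : p ≠ 2) {ζ : K}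
    {θ : L} (hθ : IsPrimitiveRoot θ (p ^ (j + 2))) (hζ : algebraMap K L ζ = θ ^ p) :
    IsCyclotomicStep p j K
      (⟨ζ, Algebra.self_mem_adjoin_singleton ℤ_[p] ζ⟩ : Algebra.adjoin ℤ_[p] {ζ}) θ where
  ne_two := hp2
  primitiveRoot := by
    refine IsPrimitiveRoot.coe_submonoidClass_iff.mp (?_ : IsPrimitiveRoot ζ _)
    refine IsPrimitiveRoot.of_map_of_injective (f := algebraMap K L) ?_ (algebraMap K L).injective
    rw [hζ]
    exact hθ.pow (pow_pos hp.out.pos _) (pow_succ' p (j + 1))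
  adjoin_eq_top := by
    rw [← Algebra.adjoin_adjoin_coe_preimage]
    congr 1
    ext a
    exact Subtype.ext_iff
  complete := by
    have : IsIntegral ℤ_[p] ζ := by
      have h0 : ζ ^ p ^ (j + 1) = 1 := by
        apply (algebraMap K L).injective
        rw [map_pow, hζ, ← pow_mul, ← pow_succ', hθ.pow_eq_one, map_one]
      exact IsIntegral.of_pow (pow_pos hp.out.pos _) (h0 ▸ isIntegral_one)
    have : Module.Finite ℤ_[p] (Algebra.adjoin ℤ_[p] {ζ}) :=
      Module.Finite.iff_fg.mpr this.fg_adjoin_singleton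
    exact isAdicComplete_of_finite p _
  pow_eq := hζ.symm
  finrank_eq := finrank_eq_prime j
  adjoin_field_eq_top := by
    have hne : NeZero (p ^ (j + 2)) := ⟨pow_ne_zero _ hp.out.ne_zero⟩
    have := IsCyclotomicExtension.adjoin_primitive_root_eq_top (A := ℚ_[p]) hθ
    rw [eq_top_iff]
    intro x _
    have hx : x ∈ Algebra.adjoin ℚ_[p] {θ} := this ▸ Algebra.mem_top
    have h1 : Algebra.adjoin ℚ_[p] {θ} ≤ (Algebra.adjoin K {θ}).restrictScalars ℚ_[p] :=
      Algebra.adjoin_le Algebra.subset_adjoin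
    exact h1 hx

theorem mem_normMonoid_of_norm_eq [IsCyclotomicExtension {p ^ (j + 1)} ℚ_[p] K]
    [IsCyclotomicExtension {p ^ (j + 2)} ℚ_[p] L]
    (hp2 : p ≠ 2) {x : K} (hx : Algebra.norm ℚ_[p] x = p) :
    x ∈ normMonoid K L := by
  let : Algebra ℤ_[p] K := ((algebraMap ℚ_[p] K).comp (algebraMap ℤ_[p] ℚ_[p])).toAlgebra
  have : IsScalarTower ℤ_[p] ℚ_[p] K := IsScalarTower.of_algebraMap_eq fun _ => rfl
  have : CharZero K := charZero_of_injective_algebraMap (algebraMap ℚ_[p] K).injective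
  have hne : NeZero (p ^ (j + 1)) := ⟨pow_ne_zero _ hp.out.ne_zero⟩
  have hne' : NeZero (p ^ (j + 2)) := ⟨pow_ne_zero _ hp.out.ne_zero⟩
  have hθ := IsCyclotomicExtension.zeta_spec (p ^ (j + 2)) ℚ_[p] L
  set θ := IsCyclotomicExtension.zeta (p ^ (j + 2)) ℚ_[p] L
  have hθp : IsPrimitiveRoot (θ ^ p) (p ^ (j + 1)) :=
    hθ.pow (pow_pos hp.out.pos _) (pow_succ' p (j + 1))
  obtain ⟨ζ, hζ⟩ : ∃ ζ : K, algebraMap K L ζ = θ ^ p := by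
    have h1 := (IsCyclotomicExtension.zeta_spec (p ^ (j + 1)) ℚ_[p] K).map_of_injective
      (algebraMap K L).injective
    obtain ⟨i, -, hi⟩ := h1.eq_pow_of_pow_eq_one hθp.pow_eq_one
    exact ⟨_, (map_pow _ _ _).trans hi⟩
  have hζ' : IsPrimitiveRoot ζ (p ^ (j + 1)) :=
    IsPrimitiveRoot.of_map_of_injective (hζ ▸ hθp) (algebraMap K L).injective
  have hstep := isCyclotomicStep j hp2 hθ hζ
  let A := Algebra.adjoin ℤ_[p] {ζ}
  have : IsFractionRing A K := isFractionRing_adjoin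
    (IsCyclotomicExtension.adjoin_primitive_root_eq_top (A := ℚ_[p]) hζ')
  have hirr := irreducible_cyclotomic p j
  have : IsGalois ℚ_[p] K := IsCyclotomicExtension.isGalois {p ^ (j + 1)} ℚ_[p] K
  have : IsGalois ℚ_[p] L := IsCyclotomicExtension.isGalois {p ^ (j + 2)} ℚ_[p] L
  have : FiniteDimensional ℚ_[p] K :=
    IsCyclotomicExtension.finiteDimensional {p ^ (j + 1)} ℚ_[p] K
  have : IsCyclic (K ≃ₐ[ℚ_[p]] K) :=
    have := ZMod.isCyclic_units_of_prime_pow p hp.out hp2 (j + 1)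
    isCyclic_of_injective (IsCyclotomicExtension.autEquivPow K hirr).toMonoidHom
      (IsCyclotomicExtension.autEquivPow K hirr).injective
  obtain ⟨g, hg⟩ := IsCyclic.exists_generator (α := K ≃ₐ[ℚ_[p]] K)
  have hnorm := hζ'.norm_sub_one_of_prime_ne_two hirr hp2
  have hp0 : (p : ℚ_[p]) ≠ 0 := Nat.cast_ne_zero.mpr hp.out.ne_zero
  have hζ1 : ζ - 1 ≠ 0 := by
    intro h
    rw [h, Algebra.norm_zero] at hnorm
    exact hp0 hnorm.symm
  obtain ⟨y, hy⟩ := groupCohomology.exists_div_of_norm_eq_one hg (x := x / (ζ - 1)) (by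
    have h := congrArg (Algebra.norm ℚ_[p]) (div_mul_cancel₀ x hζ1)
    rw [map_mul, hx, hnorm] at h
    exact (mul_eq_right₀ hp0).mp h)
  have hgN (z : K) (hz : z ∈ normMonoid K L) : g z ∈ normMonoid K L := by
    obtain ⟨w, rfl⟩ := hz
    refine ⟨g.liftNormal L w, ?_⟩
    have h := Algebra.norm_eq_of_equiv_equiv g.toRingEquiv (g.liftNormal L).toRingEquiv
      (by ext z; simp) w
    exact (g.toRingEquiv.symm_apply_eq.mp h.symm)
  obtain ⟨s, hs, hgs⟩ : ∃ s : ℕ, ¬ p ∣ s ∧ g ζ = ζ ^ s := by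
    obtain ⟨s, -, hs, h⟩ := hζ'.isPrimitiveRoot_iff.mp (hζ'.map_of_injective g.injective)
    exact ⟨s, (Nat.Prime.coprime_iff_not_dvd hp.out).mp
      (Nat.Coprime.coprime_dvd_right (dvd_pow_self p j.succ_ne_zero) hs).symm, h.symm⟩
  let gZ : K →ₐ[ℤ_[p]] K := g.toAlgHom.restrictScalars ℤ_[p]
  have hgA (a : A) : gZ a ∈ A := by
    have h1 : A ≤ A.comap gZ := Algebra.adjoin_le (by
      rw [Set.singleton_subset_iff]
      change g ζ ∈ A
      rw [hgs]
      exact pow_mem (Algebra.self_mem_adjoin_singleton _ _) s)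
    exact h1 a.2
  let τ : A →ₐ[ℤ_[p]] A := (gZ.comp A.val).codRestrict A hgA
  have hmem := hstep.map_div_mem_normMonoid (τ := τ.toRingHom) (s := s)
    (Subtype.ext hgs) hs g.toRingEquiv (fun a => rfl) hgN y.ne_zero
  have hx' : x = (ζ - 1) * (g y / y)⁻¹ := by
    rw [inv_div, hy, mul_div_cancel₀ _ hζ1]
  rw [hx']
  refine mul_mem ?_ (inv_mem_normMonoid hmem)
  exact ⟨_, hstep.norm_sub_one⟩

end Step

section Tower

theorem isCyclotomicExtension_adjoin_simple {F E : Type*} [Field F] [Field E] [Algebra F E] {m : ℕ}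
    [NeZero m] {ζ : E} (hζ : IsPrimitiveRoot ζ m) :
    IsCyclotomicExtension {m} F (IntermediateField.adjoin F {ζ}) := by
  change IsCyclotomicExtension {m} F (IntermediateField.adjoin F {ζ}).toSubalgebra
  rw [IntermediateField.adjoin_simple_toSubalgebra_of_isAlgebraic
    (hζ.isIntegral (NeZero.pos m)).tower_top.isAlgebraic]
  exact hζ.adjoin_isCyclotomicExtension F

theorem isCyclotomicExtension_trans_of_dvd {F E M : Type*} [Field F] [Field E] [Field M]
    [Algebra F E] [Algebra E M] [Algebra F M] [IsScalarTower F E M] {a b : ℕ} (hab : a ∣ b)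
    (hb : b ≠ 0) [IsCyclotomicExtension {a} F E] [IsCyclotomicExtension {b} E M] :
    IsCyclotomicExtension {b} F M := by
  have ha : NeZero a := ⟨ne_zero_of_dvd_ne_zero hb hab⟩
  have h := IsCyclotomicExtension.trans {a} {b} F E M (algebraMap E M).injective
  rw [Set.union_comm] at h
  exact (IsCyclotomicExtension.iff_union_of_dvd F M ⟨b, Set.mem_singleton b, hb, hab⟩).mpr h

variable {p : ℕ} [hp : Fact p.Prime]

theorem mem_normMonoid_of_norm_eq_of_tower (hp2 : p ≠ 2) (j k : ℕ) {K L : Type} [Field K] [Field L]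
    [Algebra ℚ_[p] K] [Algebra ℚ_[p] L] [Algebra K L] [IsScalarTower ℚ_[p] K L]
    [IsCyclotomicExtension {p ^ (j + 1)} ℚ_[p] K]
    [IsCyclotomicExtension {p ^ (j + k + 1)} ℚ_[p] L] {x : K} (hx : Algebra.norm ℚ_[p] x = p) :
    x ∈ normMonoid K L := by
  have hne (i : ℕ) : NeZero (p ^ i) := ⟨pow_ne_zero _ hp.out.ne_zero⟩
  induction k generalizing L with
  | zero =>
    have h1 := IsCyclotomicExtension.finrank K (irreducible_cyclotomic p j)
    have h2 := IsCyclotomicExtension.finrank L (irreducible_cyclotomic p j)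
    have h3 := Module.finrank_mul_finrank ℚ_[p] K L
    rw [h1, h2, Nat.mul_eq_left (Nat.totient_pos.mpr (NeZero.pos _)).ne'] at h3
    refine ⟨algebraMap K L x, ?_⟩
    rw [Algebra.norm_algebraMap, h3, pow_one]
  | succ k ih =>
    have hθ := IsCyclotomicExtension.zeta_spec (p ^ (j + (k + 1) + 1)) ℚ_[p] L
    set θ := IsCyclotomicExtension.zeta (p ^ (j + (k + 1) + 1)) ℚ_[p] L
    have hθp : IsPrimitiveRoot (θ ^ p) (p ^ (j + k + 1)) :=
      hθ.pow (NeZero.pos _) (pow_succ' p (j + k + 1))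
    let M := IntermediateField.adjoin K {θ ^ p}
    have hKM : IsCyclotomicExtension {p ^ (j + k + 1)} K M :=
      isCyclotomicExtension_adjoin_simple hθp
    have hM : IsCyclotomicExtension {p ^ (j + k + 1)} ℚ_[p] M :=
      isCyclotomicExtension_trans_of_dvd (E := K) (pow_dvd_pow p (by lia : j + 1 ≤ j + k + 1))
        (hne _).out
    have hfin : FiniteDimensional ℚ_[p] L :=
      IsCyclotomicExtension.finiteDimensional {p ^ (j + (k + 1) + 1)} ℚ_[p] L
    have hfin' : FiniteDimensional K L := FiniteDimensional.right ℚ_[p] K L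
    obtain ⟨y, rfl⟩ := ih (L := M)
    have hy : Algebra.norm ℚ_[p] y = p := by
      rw [← hx, Algebra.norm_norm]
    have hL : IsCyclotomicExtension {p ^ (j + k + 2)} ℚ_[p] L := ‹_›
    have htower : IsScalarTower ℚ_[p] M L :=
      IsScalarTower.of_algebraMap_eq fun c => by
        rw [IsScalarTower.algebraMap_apply ℚ_[p] K L, IsScalarTower.algebraMap_apply ℚ_[p] K M,
          ← IsScalarTower.algebraMap_apply K M L]
    obtain ⟨z, rfl⟩ := mem_normMonoid_of_norm_eq (L := L) (j + k) hp2 hy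
    exact ⟨z, (Algebra.norm_norm).symm⟩

end Tower

end PadicCyclotomic

/-- Let `K = ℚ_p(ζ_{p^n})` and `L = ℚ_p(ζ_{p^{2n}})` with
`ζ_{p^{2n}}^{p^n} = ζ_{p^n}`.  If `λ ∈ K^×` satisfies `N_{K/ℚ_p}(λ) = p`, then `λ` is a
norm from `L`. -/
theorem lambda_is_norm (p : ℕ) [Fact p.Prime] (hp : Odd p) (n : ℕ) (hn : 1 ≤ n)
    (Ω : Type) [Field Ω] [Algebra ℚ_[p] Ω]
    (ζ2 : Ω) (hζ2 : IsPrimitiveRoot ζ2 (p ^ (2 * n)))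
    (lam : IntermediateField.adjoin ℚ_[p] {ζ2 ^ (p ^ n)})
    (hlam : lam ≠ 0)
    (hnorm : Algebra.norm ℚ_[p] lam = (p : ℚ_[p])) :
    ∃ z : IntermediateField.adjoin
        (↥(IntermediateField.adjoin ℚ_[p] {ζ2 ^ (p ^ n)})) {ζ2},
      Algebra.norm (↥(IntermediateField.adjoin ℚ_[p] {ζ2 ^ (p ^ n)})) z = lam := by
  obtain ⟨j, rfl⟩ := Nat.exists_eq_add_of_le' hn
  have hne (i : ℕ) : NeZero (p ^ i) := ⟨pow_ne_zero _ (Fact.out : p.Prime).ne_zero⟩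
  have hζ : IsPrimitiveRoot (ζ2 ^ p ^ (j + 1)) (p ^ (j + 1)) :=
    hζ2.pow (NeZero.pos _) (by rw [← pow_add, two_mul])
  have hK := PadicCyclotomic.isCyclotomicExtension_adjoin_simple (F := ℚ_[p]) hζ
  have hKL := PadicCyclotomic.isCyclotomicExtension_adjoin_simple
    (F := IntermediateField.adjoin ℚ_[p] {ζ2 ^ p ^ (j + 1)}) hζ2
  have hL := PadicCyclotomic.isCyclotomicExtension_trans_of_dvd (F := ℚ_[p])
    (E := IntermediateField.adjoin ℚ_[p] {ζ2 ^ p ^ (j + 1)})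
    (M := IntermediateField.adjoin (IntermediateField.adjoin ℚ_[p] {ζ2 ^ p ^ (j + 1)}) {ζ2})
    (pow_dvd_pow p (by lia : j + 1 ≤ 2 * (j + 1))) (hne _).out
  rw [show 2 * (j + 1) = j + (j + 1) + 1 by lia] at hL
  exact PadicCyclotomic.mem_normMonoid_of_norm_eq_of_tower (by rintro rfl; exact absurd hp (by decide)) j (j + 1)
    hnorm
end
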